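/- For every integer k ≥ 2 and every real ε with 0 < ε < 1/60, the constant γ_{k,ε} satisfies 1 − 8ε² ≤ γ_{k,ε} ≤ 1 − ε²/72. -/

import Mathlib

open Filter

/-- Length of a longest common subsequence of two words (words are lists of naturals). -/
noncomputable def LCSlen (w w' : List ℕ) : ℕ :=
  sSup {n | ∃ u : List ℕ, u.Sublist w ∧ u.Sublist w' ∧ u.length = n}

/-- Expected LCS length of two independent uniformly random words of lengths `n` and `m`
over the alphabet `[k] = {1, …, k}` (a word over `[k]` is encoded as a function
`Fin n → Fin k`, whose values are shifted by `1` to lie in `{1, …, k}`). -/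
noncomputable def expLCS (k n m : ℕ) : ℝ :=
  (∑ u : Fin n → Fin k, ∑ v : Fin m → Fin k,
      (LCSlen (List.ofFn fun i => (u i : ℕ) + 1) (List.ofFn fun i => (v i : ℕ) + 1) : ℝ)) /
    ((k : ℝ) ^ n * (k : ℝ) ^ m)

/-- Average of `F` over all words of length `m` over the alphabet `Fin k`. -/
noncomputable def avg (k : ℕ) : ℕ → (List (Fin k) → ℝ) → ℝ
  | 0, F => F []
  | m + 1, F => (∑ x : Fin k, avg k m fun l => F (x :: l)) / k

/-- The letter of `[k]` encoded by an element of `Fin k`. -/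
def letter {k : ℕ} (x : Fin k) : ℕ := (x : ℕ) + 1

/-- LCS length of two words over the alphabet `Fin k`. -/
noncomputable def lcs {k : ℕ} (u v : List (Fin k)) : ℕ :=
  LCSlen (u.map letter) (v.map letter)

section Average

variable {k : ℕ}

lemma avg_eq_sum (m : ℕ) (F : List (Fin k) → ℝ) :
    avg k m F = (∑ v : Fin m → Fin k, F (List.ofFn v)) / (k : ℝ) ^ m := by
  induction m generalizing F with
  | zero => simp [avg]
  | succ m ih =>
    simp only [avg, ih]
    rw [← (Fin.consEquiv fun _ : Fin (m + 1) => Fin k).sum_comp, Fintype.sum_prod_type,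
      ← Finset.sum_div, div_div, pow_succ]
    congr 1
    refine Finset.sum_congr rfl fun x _ => Finset.sum_congr rfl fun v _ => ?_
    simp [Fin.consEquiv, List.ofFn_succ]

lemma avg_mono (m : ℕ) {F G : List (Fin k) → ℝ} (h : ∀ l, F l ≤ G l) :
    avg k m F ≤ avg k m G := by
  rw [avg_eq_sum, avg_eq_sum]
  gcongr
  exact h _

lemma avg_add (m : ℕ) (F G : List (Fin k) → ℝ) :
    avg k m (fun l => F l + G l) = avg k m F + avg k m G := by
  simp only [avg_eq_sum, Finset.sum_add_distrib, add_div]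

lemma avg_const_mul (m : ℕ) (c : ℝ) (F : List (Fin k) → ℝ) :
    avg k m (fun l => c * F l) = c * avg k m F := by
  simp only [avg_eq_sum, ← Finset.mul_sum, mul_div_assoc]

lemma avg_sum {ι : Type*} (s : Finset ι) (m : ℕ) (F : ι → List (Fin k) → ℝ) :
    avg k m (fun l => ∑ i ∈ s, F i l) = ∑ i ∈ s, avg k m (F i) := by
  simp only [avg_eq_sum, ← Finset.sum_div]
  rw [Finset.sum_comm]

lemma avg_div (m : ℕ) (c : ℝ) (F : List (Fin k) → ℝ) :
    avg k m (fun l => F l / c) = avg k m F / c := by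
  simp only [avg_eq_sum, ← Finset.sum_div, div_right_comm]

lemma avg_const (hk : 0 < k) (m : ℕ) (c : ℝ) : avg k m (fun _ => c) = c := by
  have : (k : ℝ) ^ m ≠ 0 := by positivity
  simp [avg_eq_sum, this]

lemma avg_append (a b : ℕ) (F : List (Fin k) → ℝ) :
    avg k (a + b) F = avg k a fun y => avg k b fun y' => F (y ++ y') := by
  induction a generalizing F with
  | zero => simp [avg]
  | succ a ih => simp only [Nat.add_right_comm, avg, ih, List.cons_append]

lemma expLCS_eq_avg (n m : ℕ) :
    expLCS k n m = avg k n fun u => avg k m fun v => (lcs u v : ℝ) := by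
  simp only [avg_eq_sum, ← Finset.sum_div, expLCS, lcs, List.map_ofFn, div_div]
  rw [mul_comm]
  rfl

end Average

section CommonSubsequence

lemma bddAbove_length_common (w w' : List ℕ) :
    BddAbove {n | ∃ u : List ℕ, u.Sublist w ∧ u.Sublist w' ∧ u.length = n} := by
  refine ⟨w.length, ?_⟩
  rintro n ⟨u, hu, -, rfl⟩
  exact hu.length_le

lemma length_le_LCSlen {u w w' : List ℕ} (h : u.Sublist w) (h' : u.Sublist w') :
    u.length ≤ LCSlen w w' :=
  le_csSup (bddAbove_length_common w w') ⟨u, h, h', rfl⟩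

lemma exists_length_eq_LCSlen (w w' : List ℕ) :
    ∃ u : List ℕ, u.Sublist w ∧ u.Sublist w' ∧ u.length = LCSlen w w' :=
  Nat.sSup_mem (s := {n | ∃ u : List ℕ, u.Sublist w ∧ u.Sublist w' ∧ u.length = n})
    ⟨0, [], List.nil_sublist _, List.nil_sublist _, rfl⟩ (bddAbove_length_common w w')

variable {k : ℕ}

lemma lcs_mono {u u' v v' : List (Fin k)} (hu : u.Sublist u') (hv : v.Sublist v') :
    lcs u v ≤ lcs u' v' := by
  obtain ⟨t, h1, h2, h3⟩ := exists_length_eq_LCSlen (u.map letter) (v.map letter)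
  rw [lcs, ← h3]
  exact length_le_LCSlen (h1.trans (hu.map _)) (h2.trans (hv.map _))

lemma lcs_add_one_le_cons (x : Fin k) (u v : List (Fin k)) :
    lcs u v + 1 ≤ lcs (x :: u) (x :: v) := by
  obtain ⟨t, h1, h2, h3⟩ := exists_length_eq_LCSlen (u.map letter) (v.map letter)
  rw [lcs, ← h3]
  exact length_le_LCSlen (u := letter x :: t) (h1.cons_cons _) (h2.cons_cons _)

lemma lcs_le_length (u v : List (Fin k)) : lcs u v ≤ u.length := by
  obtain ⟨t, h1, h2, h3⟩ := exists_length_eq_LCSlen (u.map letter) (v.map letter)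
  rw [lcs, ← h3]
  simpa using h1.length_le

end CommonSubsequence

section Greedy

variable {k : ℕ}

/-- Greedily embedding a fixed word `z` into a random word of length `r`. -/
lemma length_sub_le_avg_lcs (hk : 0 < k) {H : ℝ} (hH : 0 < H) (r : ℕ) (z : List (Fin k)) :
    (z.length : ℝ) - ((((z.length : ℝ) - r / k) ^ 2 + r) / H + H / 4) ≤
      avg k r fun w => (lcs z w : ℝ) := by
  have hk' : (0 : ℝ) < k := by exact_mod_cast hk
  induction r generalizing z with
  | zero =>
    have h0 : (0 : ℝ) ≤ avg k 0 fun w => (lcs z w : ℝ) := by simp [avg]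
    refine le_trans ?_ h0
    have : ((z.length : ℝ) ^ 2 / H + H / 4) - z.length = (z.length - H / 2) ^ 2 / H := by
      field_simp
      ring
    have h1 : (0 : ℝ) ≤ (z.length - H / 2) ^ 2 / H := by positivity
    simp only [Nat.cast_zero, zero_div, sub_zero, add_zero]
    linarith
  | succ r ih =>
    match z with
    | [] =>
      have h0 : (0 : ℝ) ≤ avg k (r + 1) fun w => (lcs [] w : ℝ) := by
        rw [avg_eq_sum]
        positivity
      refine le_trans ?_ h0
      have : (0 : ℝ) ≤ ((((([] : List (Fin k)).length : ℝ) - (r + 1 : ℕ) / k) ^ 2 +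
        (r + 1 : ℕ)) / H + H / 4) := by positivity
      simp only [List.length_nil, Nat.cast_zero] at this ⊢
      linarith
    | a :: z =>
      rw [avg, le_div_iff₀ hk']
      have key (x : Fin k) : (z.length + 1 : ℝ) -
          (((z.length + 1 - r / k - if x = a then (1 : ℝ) else 0) ^ 2 + r) / H + H / 4) ≤
          avg k r fun w => (lcs (a :: z) (x :: w) : ℝ) := by
        split_ifs with hx
        · subst hx
          have h1 : avg k r (fun w => (lcs z w : ℝ) + 1) ≤
              avg k r fun w => (lcs (x :: z) (x :: w) : ℝ) :=
            avg_mono r fun w => by exact_mod_cast lcs_add_one_le_cons x z w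
          rw [avg_add, avg_const hk] at h1
          have h2 := ih z
          ring_nf at h1 h2 ⊢
          linarith
        · have h1 : avg k r (fun w => (lcs (a :: z) w : ℝ)) ≤
              avg k r fun w => (lcs (a :: z) (x :: w) : ℝ) :=
            avg_mono r fun w => by
              exact_mod_cast lcs_mono (List.Sublist.refl _) (List.sublist_cons_self _ _)
          have h2 := ih (a :: z)
          simp only [List.length_cons, Nat.cast_add, Nat.cast_one] at h2
          simp only [sub_zero]
          linarith
      refine le_trans ?_ (Finset.sum_le_sum fun x _ => key x)
      set Y : ℝ := z.length + 1 - r / k with hY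
      have hsum : ∑ x : Fin k, (Y - if x = a then (1 : ℝ) else 0) ^ 2 = k * Y ^ 2 - 2 * Y + 1 := by
        have (x : Fin k) : (Y - if x = a then (1 : ℝ) else 0) ^ 2 =
            Y ^ 2 + if x = a then (1 - 2 * Y) else 0 := by
          split_ifs <;> ring
        simp only [this, Finset.sum_add_distrib, Finset.sum_ite_eq', Finset.mem_univ, if_true]
        simp
        ring
      simp only [Finset.sum_sub_distrib, Finset.sum_add_distrib, ← Finset.sum_div, hsum,
        Finset.sum_const, Finset.card_univ, Fintype.card_fin, nsmul_eq_mul]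
      have e : ((((a :: z).length : ℕ) : ℝ) - ((r + 1 : ℕ) : ℝ) / k) = Y - 1 / k := by
        push_cast [List.length_cons]
        rw [hY]
        ring
      rw [e]
      push_cast [List.length_cons]
      have : k * (((Y - 1 / k) ^ 2 + (r + 1)) / H) - (k * Y ^ 2 - 2 * Y + 1 + k * r) / H =
          (1 / k + (k - 1)) / H := by
        field_simp
        ring
      have h3 : (0 : ℝ) ≤ (1 / k + (k - 1)) / H := by
        have : (1 : ℝ) ≤ k := by exact_mod_cast hk
        have : (0 : ℝ) ≤ 1 / k := by positivity
        exact div_nonneg (by linarith) hH.le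
      linarith

end Greedy

section TwoLines

variable {k : ℕ}

/-- Best score available to two competing embeddings of `p ++ l :: v` into `w`: one has matched
nothing yet, the other one is about to match `l`, having skipped a single letter of `p`. -/
noncomputable def duoScore (p : List (Fin k)) (l : Fin k) (v w : List (Fin k)) : ℕ :=
  max (lcs (p ++ l :: v) w) (p.length - 1 + lcs (l :: v) w)

lemma duoScore_skip (p : List (Fin k)) (l x : Fin k) (v w : List (Fin k)) :
    duoScore p l v w ≤ duoScore p l v (x :: w) := by
  have h1 := lcs_mono (List.Sublist.refl (p ++ l :: v)) (List.sublist_cons_self x w)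
  have h2 := lcs_mono (List.Sublist.refl (l :: v)) (List.sublist_cons_self x w)
  unfold duoScore
  omega

lemma duoScore_back (p : List (Fin k)) (l x : Fin k) (v w : List (Fin k)) :
    duoScore p l v w + 1 ≤ duoScore (x :: p) l v (x :: w) := by
  have h1 := lcs_add_one_le_cons x (p ++ l :: v) w
  have h2 := lcs_mono (List.Sublist.refl (l :: v)) (List.sublist_cons_self x w)
  have h3 : lcs (l :: v) w ≤ lcs (p ++ l :: v) w :=
    lcs_mono (List.sublist_append_right _ _) (List.Sublist.refl _)
  simp only [duoScore, List.length_cons, List.cons_append]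
  omega

lemma duoScore_front (p : List (Fin k)) (l y : Fin k) (v w : List (Fin k)) :
    duoScore (p ++ [l]) y v w ≤ duoScore p l (y :: v) (l :: w) := by
  have h1 := lcs_mono (List.Sublist.refl (p ++ l :: y :: v)) (List.sublist_cons_self l w)
  have h2 := lcs_add_one_le_cons l (y :: v) w
  have h3 : lcs (l :: y :: v) (l :: w) ≤ lcs (p ++ l :: y :: v) (l :: w) :=
    lcs_mono (List.sublist_append_right _ _) (List.Sublist.refl _)
  simp only [duoScore, List.length_append, List.length_singleton, List.append_assoc,
    List.cons_append, List.nil_append]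
  omega

lemma duoScore_both (p : List (Fin k)) (l y : Fin k) (v w : List (Fin k)) :
    duoScore (p ++ [l]) y v w + 1 ≤ duoScore (l :: p) l (y :: v) (l :: w) := by
  have h1 := lcs_add_one_le_cons l (p ++ l :: y :: v) w
  have h2 := lcs_add_one_le_cons l (y :: v) w
  simp only [duoScore, List.length_append, List.append_assoc, List.cons_append,
    List.nil_append, List.length_cons, List.length_nil]
  omega

lemma duoScore_nil_match (l y : Fin k) (v w : List (Fin k)) :
    duoScore [] y v w + 1 ≤ duoScore [] l (y :: v) (l :: w) := by
  have h1 := lcs_add_one_le_cons l (y :: v) w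
  simp only [duoScore, List.length_nil, List.nil_append]
  omega

lemma duoScore_nil_drop (l x y : Fin k) (v w : List (Fin k)) :
    duoScore [l] y v w ≤ duoScore [] l (y :: v) (x :: w) := by
  have h1 := lcs_mono (List.Sublist.refl (l :: y :: v)) (List.sublist_cons_self x w)
  have h3 : lcs (y :: v) w ≤ lcs (l :: y :: v) w :=
    lcs_mono (List.sublist_cons_self _ _) (List.Sublist.refl _)
  simp only [duoScore, List.length_nil, List.nil_append, List.length_singleton, List.cons_append]
  omega

lemma duoScore_commit (p : List (Fin k)) (l : Fin k) (v w : List (Fin k)) :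
    p.length - 1 + duoScore [] l v w ≤ duoScore p l v w := by
  simp only [duoScore, List.length_nil, List.nil_append]
  omega

/-- Expected score of the two competing embeddings when `t` letters of the first word are yet to
be revealed and `r` letters of the second word are left. -/
noncomputable def duoValue (t r : ℕ) (p : List (Fin k)) (l : Fin k) : ℝ :=
  avg k t fun v => avg k r fun w => (duoScore p l v w : ℝ)

/-- Expected score after the letter `x` of the second word has been revealed. -/
noncomputable def duoNext (t r : ℕ) (p : List (Fin k)) (l x : Fin k) : ℝ :=
  (∑ y : Fin k, avg k t fun v => avg k r fun w => (duoScore p l (y :: v) (x :: w) : ℝ)) / k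

lemma duoValue_succ_succ (t r : ℕ) (p : List (Fin k)) (l : Fin k) :
    duoValue (t + 1) (r + 1) p l = (∑ x, duoNext t r p l x) / k := by
  simp only [duoValue, duoNext, avg, avg_div, avg_sum, ← Finset.sum_div]
  rw [Finset.sum_comm]

lemma duoNext_skip (t r : ℕ) (p : List (Fin k)) (l x : Fin k) :
    duoValue (t + 1) r p l ≤ duoNext t r p l x := by
  simp only [duoValue, duoNext, avg]
  gcongr with y
  refine avg_mono t fun v => avg_mono r fun w => ?_
  exact_mod_cast duoScore_skip p l x (y :: v) w

lemma avg_avg_add_one (hk : 0 < k) (t r : ℕ) (F : List (Fin k) → List (Fin k) → ℝ) :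
    (avg k t fun v => avg k r fun w => F v w + 1) =
      (avg k t fun v => avg k r fun w => F v w) + 1 := by
  simp only [avg_add, avg_const hk]

lemma duoNext_back (hk : 0 < k) (t r : ℕ) (p : List (Fin k)) (l x : Fin k) :
    duoValue (t + 1) r p l + 1 ≤ duoNext t r (x :: p) l x := by
  rw [duoValue, ← avg_avg_add_one hk]
  simp only [duoNext, avg]
  gcongr with y
  refine avg_mono t fun v => avg_mono r fun w => ?_
  exact_mod_cast duoScore_back p l x (y :: v) w

lemma duoNext_front (t r : ℕ) (p : List (Fin k)) (l : Fin k) :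
    (∑ y, duoValue t r (p ++ [l]) y) / k ≤ duoNext t r p l l := by
  simp only [duoValue, duoNext]
  gcongr with y
  refine avg_mono t fun v => avg_mono r fun w => ?_
  exact_mod_cast duoScore_front p l y v w

lemma duoNext_both (hk : 0 < k) (t r : ℕ) (p : List (Fin k)) (l : Fin k) :
    (∑ y, (duoValue t r (p ++ [l]) y + 1)) / k ≤ duoNext t r (l :: p) l l := by
  simp only [duoValue, duoNext, ← avg_avg_add_one hk]
  gcongr with y
  refine avg_mono t fun v => avg_mono r fun w => ?_
  exact_mod_cast duoScore_both p l y v w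

lemma duoNext_nil_match (hk : 0 < k) (t r : ℕ) (l : Fin k) :
    (∑ y : Fin k, (duoValue t r [] y + 1)) / k ≤ duoNext t r [] l l := by
  simp only [duoValue, duoNext, ← avg_avg_add_one hk]
  gcongr with y
  refine avg_mono t fun v => avg_mono r fun w => ?_
  exact_mod_cast duoScore_nil_match l y v w

lemma duoNext_nil_drop (t r : ℕ) (l x : Fin k) :
    (∑ y, duoValue t r [l] y) / k ≤ duoNext t r [] l x := by
  simp only [duoValue, duoNext]
  gcongr with y
  refine avg_mono t fun v => avg_mono r fun w => ?_
  exact_mod_cast duoScore_nil_drop l x y v w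

lemma duoValue_commit (hk : 0 < k) (t r : ℕ) (p : List (Fin k)) (l : Fin k) :
    (p.length : ℝ) - 1 + duoValue t r [] l ≤ duoValue t r p l := by
  have h : avg k t (fun v => avg k r fun w => ((p.length : ℝ) - 1) + (duoScore [] l v w : ℝ)) ≤
      duoValue t r p l := by
    refine avg_mono t fun v => avg_mono r fun w => ?_
    have := duoScore_commit p l v w
    have h2 : p.length ≤ (p.length - 1) + 1 := by omega
    have h3 : (p.length : ℝ) ≤ ((p.length - 1 : ℕ) : ℝ) + 1 := by exact_mod_cast h2
    have h4 : ((p.length - 1 : ℕ) : ℝ) + duoScore [] l v w ≤ duoScore p l v w := by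
      exact_mod_cast this
    linarith
  simpa only [duoValue, avg_add, avg_const hk] using h

lemma duoValue_nonneg (t r : ℕ) (p : List (Fin k)) (l : Fin k) : 0 ≤ duoValue t r p l := by
  simp only [duoValue, avg_eq_sum]
  positivity

lemma greedy_le_duoValue (hk : 0 < k) {H : ℝ} (hH : 0 < H) (t r : ℕ) (p : List (Fin k))
    (l : Fin k) :
    (t + p.length + 1 : ℝ) - ((((t + p.length + 1 : ℝ) - r / k) ^ 2 + r) / H + H / 4) ≤
      duoValue t r p l := by
  have h (v : Fin t → Fin k) :
      (t + p.length + 1 : ℝ) - ((((t + p.length + 1 : ℝ) - r / k) ^ 2 + r) / H + H / 4) ≤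
        avg k r fun w => (duoScore p l (List.ofFn v) w : ℝ) := by
    have h1 := length_sub_le_avg_lcs hk hH r (p ++ l :: List.ofFn v)
    have h2 : ((p ++ l :: List.ofFn v).length : ℝ) = t + p.length + 1 := by
      simp
      ring
    rw [h2] at h1
    refine h1.trans (avg_mono r fun w => ?_)
    exact_mod_cast le_max_left _ _
  have hk' : (0 : ℝ) < (k : ℝ) ^ t := by positivity
  rw [duoValue, avg_eq_sum, le_div_iff₀ hk']
  calc _ = ∑ v : Fin t → Fin k, ((t + p.length + 1 : ℝ) -
        ((((t + p.length + 1 : ℝ) - r / k) ^ 2 + r) / H + H / 4)) := by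
          rw [Finset.sum_const, Finset.card_univ, Fintype.card_fun, Fintype.card_fin,
            Fintype.card_fin, nsmul_eq_mul, mul_comm]
          push_cast
          rfl
    _ ≤ _ := Finset.sum_le_sum fun v _ => h v

end TwoLines

section TwoLinesPotential

variable {k : ℕ}

/-- Potential of the state of two competing embeddings: it grows at a positive average rate. -/
noncomputable def gapPot : List (Fin k) → Fin k → ℝ
  | [], _ => 0
  | h :: p, l => ((p.length : ℝ) + 1) ^ 2 + if h = l then 0 else 1

lemma gapPot_cons (h : Fin k) (p : List (Fin k)) (l : Fin k) :
    gapPot (h :: p) l = ((p.length : ℝ) + 1) ^ 2 + if h = l then 0 else 1 := rfl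

lemma sq_length_le_gapPot (p : List (Fin k)) (l : Fin k) : (p.length : ℝ) ^ 2 ≤ gapPot p l := by
  cases p with
  | nil => simp [gapPot]
  | cons h p =>
    simp only [gapPot, List.length_cons, Nat.cast_add, Nat.cast_one]
    split_ifs <;> linarith

lemma gapPot_le {K : ℕ} {p : List (Fin k)} (hp : p.length ≤ K) (l : Fin k) :
    gapPot p l ≤ (K : ℝ) ^ 2 + 1 := by
  have h0 : (p.length : ℝ) ≤ K := by exact_mod_cast hp
  have h1 : (p.length : ℝ) ^ 2 ≤ (K : ℝ) ^ 2 := by gcongr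
  cases p with
  | nil =>
    simp only [gapPot]
    positivity
  | cons h p =>
    simp only [gapPot, List.length_cons, Nat.cast_add, Nat.cast_one] at h1 ⊢
    split_ifs <;> linarith

lemma gapPot_concat (p : List (Fin k)) (l y : Fin k) :
    gapPot (p ++ [l]) y = ((p.length : ℝ) + 1) ^ 2 + if p.headD l = y then 0 else 1 := by
  cases p with
  | nil => simp [gapPot]
  | cons h p => simp [gapPot]

lemma sum_mismatch (a : Fin k) : ∑ y : Fin k, (if a = y then (0 : ℝ) else 1) = k - 1 := by
  have (y : Fin k) : (if a = y then (0 : ℝ) else 1) = 1 - if a = y then 1 else 0 := by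
    split_ifs <;> simp
  simp [this]

/-- Lower bound for the expected score of two competing embeddings with `T` letters left. -/
noncomputable def duoBound (k K : ℕ) (H : ℝ) (c r T : ℕ) (Q : ℝ) : ℝ :=
  T - c - (((T - K * c - r / k) ^ 2 + (max (c * (K ^ 2 + 1) - (k - 1) / k ^ 2 * r - Q) 0) ^ 2 +
    (1 + (2 * K + 2) ^ 2) * r) / H + (H / 2 + (K ^ 2 + K + 3)))

/-- Lower bound for the score after revealing letters which make the number of matches grow by
`α` and the potential grow by `q`. -/
noncomputable def duoStepBound (k K : ℕ) (H : ℝ) (c r T : ℕ) (Q α q : ℝ) : ℝ :=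
  T - c - (((T - K * c - (r + 1 : ℕ) / k + 1 / k - α) ^ 2 +
    (max (c * (K ^ 2 + 1) - (k - 1) / k ^ 2 * (r + 1 : ℕ) - Q) 0 + (k - 1) / k ^ 2 - q) ^ 2 +
    (1 + (2 * K + 2) ^ 2) * r) / H + (H / 2 + (K ^ 2 + K + 3)))

lemma duoStepBound_le {K : ℕ} {H : ℝ} (hH : 0 < H) {c r T T' : ℕ} {Q Q' α q : ℝ}
    (hT : (T' : ℝ) + α = T) (hQ : Q + q ≤ Q') :
    duoStepBound k K H c r T Q α q ≤ duoBound k K H c r T' Q' + α := by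
  unfold duoStepBound duoBound
  have h1 : ((T : ℝ) - K * c - (r + 1 : ℕ) / k + 1 / k - α) = T' - K * c - r / k := by
    rw [← hT]
    push_cast
    ring
  have h2 : (max (c * ((K : ℝ) ^ 2 + 1) - (k - 1) / k ^ 2 * r - Q') 0) ^ 2 ≤
      (max (c * ((K : ℝ) ^ 2 + 1) - (k - 1) / k ^ 2 * (r + 1 : ℕ) - Q) 0 +
        (k - 1) / k ^ 2 - q) ^ 2 := by
    rw [← sq_abs (max _ _ + _ - _)]
    gcongr
    refine max_le ?_ (abs_nonneg _)
    refine le_trans ?_ (le_abs_self _)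
    have := le_max_left (c * ((K : ℝ) ^ 2 + 1) - (k - 1) / k ^ 2 * (r + 1 : ℕ) - Q) 0
    push_cast at this ⊢
    linarith
  rw [h1, ← hT]
  have h3 := div_le_div_of_nonneg_right (add_le_add_left (add_le_add_right h2
    ((T' - K * c - r / k : ℝ) ^ 2)) ((1 + (2 * K + 2) ^ 2) * r : ℝ)) hH.le
  linarith

lemma sum_sq_drift_le (hk : 0 < k) {α : Fin k → ℝ} {q : Fin k → Fin k → ℝ} {b Y P : ℝ}
    (hα : ∀ x, α x ^ 2 = α x) (hα1 : ∑ x, α x = 1) (hq : (k : ℝ) - 1 ≤ ∑ x, ∑ y, q x y)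
    (hb : ∀ x y, |(k - 1) / k ^ 2 - q x y| ≤ b) (hP : 0 ≤ P) :
    ∑ x, ∑ y, ((Y + 1 / k - α x) ^ 2 + (P + (k - 1) / k ^ 2 - q x y) ^ 2) ≤
      k ^ 2 * (Y ^ 2 + 1 + P ^ 2 + b ^ 2) := by
  have hk' : (0 : ℝ) < k := by exact_mod_cast hk
  set ρ : ℝ := (k - 1) / k ^ 2 with hρ
  have hρk : (k : ℝ) ^ 2 * ρ = k - 1 := by
    rw [hρ]
    field_simp
  have e1 (x : Fin k) : (Y + 1 / k - α x) ^ 2 =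
      (Y + 1 / k) ^ 2 + (1 - 2 * (Y + 1 / k)) * α x := by
    rw [sub_sq, hα]
    ring
  have e2 (x y : Fin k) : (P + ρ - q x y) ^ 2 ≤ P ^ 2 + 2 * P * ρ + b ^ 2 - 2 * P * q x y := by
    have := sq_le_sq.mpr ((hb x y).trans (le_abs_self b))
    nlinarith
  calc _ ≤ ∑ x, ∑ y, ((Y + 1 / k) ^ 2 + (1 - 2 * (Y + 1 / k)) * α x +
        (P ^ 2 + 2 * P * ρ + b ^ 2 - 2 * P * q x y)) := by
        gcongr with x _ y _
        · exact (e1 x).le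
        · exact e2 x y
    _ = k ^ 2 * (Y + 1 / k) ^ 2 + k * (1 - 2 * (Y + 1 / k)) + k ^ 2 * (P ^ 2 + b ^ 2)
        + 2 * P * (k ^ 2 * ρ - ∑ x, ∑ y, q x y) := by
        simp only [Finset.sum_add_distrib, Finset.sum_sub_distrib, ← Finset.mul_sum,
          Finset.sum_const, Finset.card_univ, Fintype.card_fin, nsmul_eq_mul, hα1]
        ring
    _ ≤ k ^ 2 * (Y + 1 / k) ^ 2 + k * (1 - 2 * (Y + 1 / k)) + k ^ 2 * (P ^ 2 + b ^ 2) := by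
        rw [hρk]
        nlinarith
    _ = k ^ 2 * (Y ^ 2 + P ^ 2 + b ^ 2) + (k - 1) := by
        field_simp
        ring
    _ ≤ _ := by nlinarith

lemma duoBound_le_of_step (hk : 0 < k) {K : ℕ} {H : ℝ} (hH : 0 < H) {c r T : ℕ} {Q : ℝ}
    {α : Fin k → ℝ} {q : Fin k → Fin k → ℝ} {V : Fin k → ℝ}
    (hα : ∀ x, α x ^ 2 = α x) (hα1 : ∑ x, α x = 1) (hq : (k : ℝ) - 1 ≤ ∑ x, ∑ y, q x y)
    (hb : ∀ x y, |((k : ℝ) - 1) / k ^ 2 - q x y| ≤ 2 * (K : ℝ) + 2)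
    (hV : ∀ x, (∑ y, duoStepBound k K H c r T Q (α x) (q x y)) / k ≤ V x) :
    duoBound k K H c (r + 1) T Q ≤ (∑ x, V x) / k := by
  have hk' : (0 : ℝ) < k := by exact_mod_cast hk
  refine le_trans ?_ (div_le_div_of_nonneg_right (Finset.sum_le_sum fun x _ => hV x) hk'.le)
  rw [← Finset.sum_div, div_div, le_div_iff₀ (by positivity)]
  set P := max (c * ((K : ℝ) ^ 2 + 1) - (k - 1) / k ^ 2 * (r + 1 : ℕ) - Q) 0 with hP
  set Y : ℝ := T - K * c - (r + 1 : ℕ) / k with hY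
  have key := sum_sq_drift_le hk hα hα1 hq hb (le_max_right _ _ : 0 ≤ P) (Y := Y)
  simp only [duoStepBound, duoBound, ← hP, ← hY]
  have e : ∑ x, ∑ y, ((T : ℝ) - c - (((Y + 1 / k - α x) ^ 2 + (P + (k - 1) / k ^ 2 - q x y) ^ 2 +
      (1 + (2 * K + 2) ^ 2) * r) / H + (H / 2 + (K ^ 2 + K + 3)))) =
      k * k * (T - c - ((1 + (2 * K + 2) ^ 2) * r / H + (H / 2 + (K ^ 2 + K + 3)))) -
      (∑ x, ∑ y, ((Y + 1 / k - α x) ^ 2 + (P + (k - 1) / k ^ 2 - q x y) ^ 2)) / H := by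
    simp only [Finset.sum_sub_distrib, Finset.sum_add_distrib, ← Finset.sum_div,
      Finset.sum_const, Finset.card_univ, Fintype.card_fin, nsmul_eq_mul]
    ring
  rw [e]
  have key' := div_le_div_of_nonneg_right key hH.le
  push_cast
  have e2 : (k : ℝ) ^ 2 * (Y ^ 2 + 1 + P ^ 2 + (2 * K + 2) ^ 2) / H =
      k * k * ((Y ^ 2 + P ^ 2 + (1 + (2 * K + 2) ^ 2) * (r + 1)) / H) -
      k * k * ((1 + (2 * K + 2) ^ 2) * r / H) := by
    ring
  rw [e2] at key'
  linarith

lemma step_bound_abs_le (hk : 0 < k) {K : ℕ} {q : ℝ} (h1 : -(2 * K : ℝ) ≤ q)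
    (h2 : q ≤ 2 * K + 2) : |((k : ℝ) - 1) / k ^ 2 - q| ≤ 2 * (K : ℝ) + 2 := by
  have hk' : (1 : ℝ) ≤ k := by exact_mod_cast hk
  have h3 : 0 ≤ ((k : ℝ) - 1) / k ^ 2 := div_nonneg (by linarith) (by positivity)
  have h4 : ((k : ℝ) - 1) / k ^ 2 ≤ 1 := by
    rw [div_le_one (by positivity)]
    nlinarith
  rw [abs_le]
  constructor <;> linarith

lemma duoBound_le_of_forall (hk : 0 < k) {K : ℕ} {H : ℝ} (hH : 0 < H) {c t r : ℕ}
    (ih : ∀ (t : ℕ) (p : List (Fin k)) (l : Fin k), p.length ≤ K →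
      duoBound k K H c r (t + p.length + 1) (gapPot p l) ≤ duoValue t r p l)
    {p : List (Fin k)} (hp : p.length < K) (l : Fin k) :
    duoBound k K H c (r + 1) (t + 1 + p.length + 1) (gapPot p l) ≤
      duoValue (t + 1) (r + 1) p l := by
  have hk' : (0 : ℝ) < k := by exact_mod_cast hk
  have hk1 : (1 : ℝ) ≤ k := by exact_mod_cast hk
  have const_avg (b : ℝ) : (∑ _y : Fin k, b) / k = b := by
    simp [hk'.ne']
  rw [duoValue_succ_succ]
  match p with
  | [] =>
    refine duoBound_le_of_step hk hH (α := fun x => if x = l then 1 else 0)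
      (q := fun x _ => if l = x then 0 else 1) (fun x => by split_ifs <;> simp) (by simp) ?_
      (fun x y => ?_) fun x => ?_
    · simp only [Finset.sum_const, Finset.card_univ, Fintype.card_fin, nsmul_eq_mul,
        ← Finset.mul_sum, sum_mismatch]
      nlinarith
    · have hK0 : (0 : ℝ) ≤ K := Nat.cast_nonneg K
      apply step_bound_abs_le hk <;> split_ifs <;> linarith
    · by_cases hx : x = l
      · subst hx
        refine le_trans ?_ (duoNext_nil_match hk t r x)
        gcongr with y
        simp only [if_true]
        refine (duoStepBound_le hH (T' := t + 1) (Q' := gapPot [] y) ?_ ?_).trans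
          (add_le_add_left (ih t [] y (by simp)) 1) <;> simp [gapPot]
      · refine le_trans ?_ (duoNext_nil_drop t r l x)
        gcongr with y
        simp only [hx, Ne.symm hx, if_false]
        refine (duoStepBound_le hH (T' := t + 1 + 1) (Q' := gapPot [l] y) ?_ ?_).trans
          ((add_zero _).trans_le (ih t [l] y hp)) <;> simp [gapPot]
        split_ifs <;> simp
  | h :: p =>
    have hpK : (p.length : ℝ) + 1 ≤ K := by exact_mod_cast hp.le
    have hp0 : (0 : ℝ) ≤ p.length := Nat.cast_nonneg _
    by_cases hl : h = l
    · subst hl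
      refine duoBound_le_of_step hk hH (α := fun x => if x = h then 1 else 0)
        (q := fun x y => if x = h then (if p.headD h = y then 0 else 1) else 0)
        (fun x => by split_ifs <;> simp) (by simp) ?_ (fun x y => ?_) fun x => ?_
      · rw [Finset.sum_eq_single h]
        · simp only [if_true, sum_mismatch]
          rfl
        · intro b _ hb
          simp [hb]
        · simp
      · apply step_bound_abs_le hk <;> split_ifs <;> linarith
      · by_cases hx : x = h
        · subst hx
          refine le_trans ?_ (duoNext_both hk t r p x)
          gcongr with y
          have := ih t (p ++ [x]) y (by simpa using hp.le)
          simp only [if_true]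
          refine (duoStepBound_le hH ?_ ?_).trans (add_le_add_left this 1)
          · simp
            ring
          · simp only [gapPot_cons, gapPot_concat, if_true, add_zero, le_refl]
        · refine le_trans ?_ (duoNext_skip t r (h :: p) h x)
          simp only [hx, if_false]
          rw [const_avg]
          refine (duoStepBound_le hH ?_ ?_).trans ((add_zero _).trans_le (ih _ _ _ hp.le)) <;>
            simp
    · refine duoBound_le_of_step hk hH (α := fun x => if x = h then 1 else 0)
        (q := fun x y => (if x = h then -(2 * ((p.length : ℝ) + 1)) else 0) +
          if x = l then 2 * ((p.length : ℝ) + 1) + (if h = y then 0 else 1) else 0)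
        (fun x => by split_ifs <;> simp) (by simp) ?_ (fun x y => ?_) fun x => ?_
      · rw [Finset.sum_comm]
        simp only [Finset.sum_add_distrib, Finset.sum_ite_eq', Finset.mem_univ, if_true,
          sum_mismatch, Finset.sum_const, Finset.card_univ, Fintype.card_fin, nsmul_eq_mul]
        linarith
      · apply step_bound_abs_le hk <;> split_ifs <;> linarith
      · by_cases hx : x = h
        · subst hx
          refine le_trans ?_ (duoNext_back hk t r p l x)
          simp only [if_true, hl, if_false]
          rw [const_avg]
          refine (duoStepBound_le hH ?_ ?_).trans
            (add_le_add_left (ih (t + 1) p l (by simp at hp; omega)) 1)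
          · simp
            ring
          · have := sq_length_le_gapPot p l
            simp only [gapPot_cons, hl, if_false]
            linarith
        · by_cases hx' : x = l
          · subst hx'
            refine le_trans ?_ (duoNext_front t r (h :: p) x)
            gcongr with y
            have := ih t (h :: p ++ [x]) y (by simpa using hp)
            simp only [if_true, hx, if_false]
            refine (duoStepBound_le hH ?_ ?_).trans ((add_zero _).trans_le this)
            · simp
              ring
            · rw [gapPot_concat]
              simp [gapPot, hl]
              ring_nf
              rfl
          · refine le_trans ?_ (duoNext_skip t r (h :: p) l x)
            simp only [hx, hx', if_false]
            rw [const_avg]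
            refine (duoStepBound_le hH ?_ ?_).trans ((add_zero _).trans_le (ih _ _ _ hp.le)) <;>
              simp

lemma le_sq_div_add {y H : ℝ} (hH : 0 < H) : y ≤ y ^ 2 / H + H / 4 := by
  have : y ^ 2 / H + H / 4 - y = (y - H / 2) ^ 2 / H := by
    field_simp
    ring
  have h1 : 0 ≤ (y - H / 2) ^ 2 / H := by positivity
  linarith

lemma duoBound_nonpos {K : ℕ} {H : ℝ} (hH : 0 < H) {c r T : ℕ} {Q : ℝ}
    (hT : T ≤ K + 1) : duoBound k K H c r T Q ≤ 0 := by
  have h1 : (T : ℝ) ≤ K + 1 := by exact_mod_cast hT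
  have h2 : 0 ≤ ((T - K * c - r / k : ℝ) ^ 2 +
      (max (c * ((K : ℝ) ^ 2 + 1) - (k - 1) / k ^ 2 * r - Q) 0) ^ 2 +
      (1 + (2 * K + 2) ^ 2) * r) / H := by positivity
  have h3 : (0 : ℝ) ≤ c := Nat.cast_nonneg c
  unfold duoBound
  nlinarith [sq_nonneg (K : ℝ)]

lemma duoBound_zero_nonpos {K : ℕ} (hK : 1 ≤ K) {H : ℝ} (hH : 0 < H) {c T : ℕ} {Q : ℝ}
    (hQ : Q ≤ (K : ℝ) ^ 2 + 1) : duoBound k K H c 0 T Q ≤ 0 := by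
  have hK' : (1 : ℝ) ≤ K := by exact_mod_cast hK
  have hc : (0 : ℝ) ≤ c := Nat.cast_nonneg c
  simp only [duoBound, Nat.cast_zero, zero_div, mul_zero, sub_zero, add_zero]
  set P := max (c * ((K : ℝ) ^ 2 + 1) - Q) 0 with hP
  have h1 := le_sq_div_add hH (y := T - K * c)
  have h2 := le_sq_div_add hH (y := P)
  have h3 : c * ((K : ℝ) ^ 2 + 1) - Q ≤ P := le_max_left _ _
  have h4 : (c : ℝ) * K ≤ c * ((K : ℝ) ^ 2 + 1) := by
    gcongr
    nlinarith
  rw [add_div]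
  linarith

/-- The expected score of two competing embeddings which may use `c` commitments. -/
lemma duoBound_le_duoValue (hk : 0 < k) {K : ℕ} (hK : 1 ≤ K) {H : ℝ} (hH : 0 < H) (r c t : ℕ)
    {p : List (Fin k)} (hp : p.length ≤ K) (l : Fin k) :
    duoBound k K H c r (t + p.length + 1) (gapPot p l) ≤ duoValue t r p l := by
  induction r generalizing c t p l with
  | zero =>
    exact (duoBound_zero_nonpos hK hH (gapPot_le hp l)).trans (duoValue_nonneg _ _ _ _)
  | succ r ihr =>
    induction c generalizing t p l with
    | zero =>
      refine le_trans ?_ (greedy_le_duoValue hk hH t (r + 1) p l)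
      simp only [duoBound]
      push_cast
      set Y : ℝ := t + p.length + 1 - (r + 1) / k with hY
      have e : (t + p.length + 1 - K * 0 - (r + 1) / k : ℝ) = Y := by
        rw [hY]
        ring
      rw [e]
      have h1 : (Y ^ 2 + (r + 1)) / H ≤ (Y ^ 2 + (max (0 * ((K : ℝ) ^ 2 + 1) -
          (k - 1) / k ^ 2 * (r + 1) - gapPot p l) 0) ^ 2 +
          (1 + (2 * K + 2) ^ 2) * (r + 1)) / H := by
        refine div_le_div_of_nonneg_right ?_ hH.le
        have h2 := sq_nonneg (max (0 * ((K : ℝ) ^ 2 + 1) -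
          (k - 1) / k ^ 2 * (r + 1) - gapPot p l) 0)
        have h3 : (0 : ℝ) ≤ (2 * K + 2) ^ 2 * (r + 1) := by positivity
        linarith
      nlinarith [sq_nonneg (K : ℝ), (Nat.cast_nonneg K : (0 : ℝ) ≤ K)]
    | succ c ihc =>
      match t with
      | 0 => exact (duoBound_nonpos hH (by omega)).trans (duoValue_nonneg _ _ _ _)
      | t + 1 =>
        rcases hp.lt_or_eq with h | h
        · exact duoBound_le_of_forall hk hH (fun t p l hp => ihr (c + 1) t hp l) h l
        · refine le_trans ?_ (duoValue_commit hk (t + 1) (r + 1) p l)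
          have h1 := ihc (t + 1) (p := []) (by simp) l
          have h2 := gapPot_le hp l
          refine le_trans ?_ (add_le_add_right h1 _)
          have h0 : gapPot [] l = 0 := rfl
          simp only [duoBound, h0, h, List.length_nil]
          push_cast
          have e : ((t : ℝ) + 1 + K + 1 - K * (c + 1) - (r + 1) / k) =
              t + 1 + 0 + 1 - K * c - (r + 1) / k := by
            ring
          rw [e]
          have h3 : max ((c : ℝ) * (K ^ 2 + 1) - (k - 1) / k ^ 2 * (r + 1) - 0) 0 ≤
              max (((c : ℝ) + 1) * (K ^ 2 + 1) - (k - 1) / k ^ 2 * (r + 1) - gapPot p l) 0 := by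
            refine max_le_max_right _ ?_
            linarith
          have h4 : (0 : ℝ) ≤ max ((c : ℝ) * (K ^ 2 + 1) - (k - 1) / k ^ 2 * (r + 1) - 0) 0 :=
            le_max_right _ _
          have h5 := pow_le_pow_left₀ h4 h3 2
          have h6 := div_le_div_of_nonneg_right (add_le_add_left (add_le_add_right h5
            ((t + 1 + 0 + 1 - K * c - (r + 1) / k : ℝ) ^ 2))
            ((1 + (2 * K + 2) ^ 2) * (r + 1) : ℝ)) hH.le
          linarith

end TwoLinesPotential

section LowerBound

variable {k : ℕ}

lemma duoBound_le_expLCS (hk : 0 < k) {K : ℕ} (hK : 1 ≤ K) {H : ℝ} (hH : 0 < H) (c m : ℕ)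
    {n : ℕ} (hn : 0 < n) : duoBound k K H c m n 0 ≤ expLCS k n m := by
  obtain ⟨N, rfl⟩ : ∃ N, n = N + 1 := ⟨n - 1, by omega⟩
  have hk' : (0 : ℝ) < k := by exact_mod_cast hk
  rw [expLCS_eq_avg, avg, le_div_iff₀ hk']
  have key (x : Fin k) : duoBound k K H c m (N + 1) 0 ≤
      avg k N fun l => avg k m fun v => (lcs (x :: l) v : ℝ) := by
    have := duoBound_le_duoValue hk hK hH m c N (p := []) (by simp) x
    refine (this.trans (avg_mono N fun v => avg_mono m fun w => ?_))
    simp [duoScore]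
  calc _ = ∑ _x : Fin k, duoBound k K H c m (N + 1) 0 := by simp [mul_comm]
    _ ≤ _ := Finset.sum_le_sum fun x _ => key x

lemma exists_commit_count (hk : 2 ≤ k) {ε : ℝ} (hε0 : 0 < ε) (hε1 : ε < 1 / 60) {K : ℕ}
    (hK : 1 / (8 * ε) ≤ K) (hK' : K ≤ 1 / (8 * ε) + 1) {n m : ℕ}
    (hnR : 10 * ((K : ℝ) ^ 2 + 2) ≤ n) (hm1 : (m : ℝ) ≤ (1 - ε) * k * n)
    (hm2 : (1 - ε) * k * n < m + 1) :
    ∃ c : ℕ, (c : ℝ) ≤ 8 * ε ^ 2 * n + 2 ∧ ((n : ℝ) - K * c - m / k) ^ 2 ≤ (K : ℝ) ^ 2 ∧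
      (c : ℝ) * (K ^ 2 + 1) - (k - 1) / k ^ 2 * m - 0 ≤ 0 := by
  have hk' : (2 : ℝ) ≤ k := by exact_mod_cast hk
  have hK0 : (0 : ℝ) < K := lt_of_lt_of_le (by positivity) hK
  have hn0 : (1 : ℝ) ≤ n := by nlinarith
  have hKε : 1 ≤ 8 * (ε * K) := by
    rw [div_le_iff₀ (by positivity)] at hK
    linarith
  have hKε' : ε * K ≤ 1 / 8 + ε := by
    calc ε * K ≤ ε * (1 / (8 * ε) + 1) := by gcongr
      _ = 1 / 8 + ε := by
        field_simp
  have hεK : ε / K ≤ 8 * ε ^ 2 := by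
    rw [div_le_iff₀ hK0]
    nlinarith
  have hmk1 : (m : ℝ) / k ≤ (1 - ε) * n := by
    rw [div_le_iff₀ (by linarith)]
    linarith
  have hmk2 : (1 - ε) * n - 1 ≤ (m : ℝ) / k := by
    rw [le_div_iff₀ (by linarith)]
    nlinarith
  have hεn : 0 ≤ ε * n := by positivity
  obtain ⟨c, hc1, hc2⟩ : ∃ c : ℕ, ((n : ℝ) - m / k) / K ≤ c ∧ c < ((n : ℝ) - m / k) / K + 1 := by
    refine ⟨_, Nat.le_ceil _, Nat.ceil_lt_add_one (div_nonneg ?_ hK0.le)⟩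
    linarith
  have hKc1 : (n : ℝ) - m / k ≤ K * c := by
    rw [div_le_iff₀ hK0] at hc1
    linarith
  have hKc2 : (K : ℝ) * c ≤ n - m / k + K := by
    have := mul_le_mul_of_nonneg_left hc2.le hK0.le
    rw [mul_add, mul_div_cancel₀ _ hK0.ne'] at this
    linarith
  have hK1 : (1 : ℝ) ≤ K := by nlinarith
  have hc3 : (c : ℝ) ≤ ε / K * n + 2 := by
    have : ((n : ℝ) - m / k) / K ≤ ε / K * n + 1 := by
      rw [div_le_iff₀ hK0]
      have : (ε / K * n + 1) * K = ε * n + K := by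
        field_simp
      linarith
    linarith
  have hY : ((n : ℝ) - K * c - m / k) ^ 2 ≤ (K : ℝ) ^ 2 := by
    apply sq_le_sq'
    · linarith
    · linarith
  have hP : (c : ℝ) * (K ^ 2 + 1) - (k - 1) / k ^ 2 * m - 0 ≤ 0 := by
    have h1 : (c : ℝ) * (K ^ 2 + 1) ≤ 15 / 100 * n + 2 * (K ^ 2 + 1) := by
      calc (c : ℝ) * (K ^ 2 + 1) ≤ (ε / K * n + 2) * (K ^ 2 + 1) := by gcongr
        _ = (ε * K + ε / K) * n + 2 * (K ^ 2 + 1) := by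
          field_simp
        _ ≤ _ := by
          gcongr
          nlinarith
    have h2 : 48 / 100 * (n : ℝ) - 1 ≤ (k - 1) / k ^ 2 * m := by
      have h3 : ((k : ℝ) - 1) / k ^ 2 * m = (1 - 1 / k) * (m / k) := by
        field_simp
      have h4 : (1 : ℝ) / 2 ≤ 1 - 1 / k := by
        have : (1 : ℝ) / k ≤ 1 / 2 := by gcongr
        linarith
      rw [h3]
      have h5 : (98 / 100 : ℝ) * n - 1 ≤ m / k := by nlinarith
      nlinarith
    linarith
  refine ⟨c, ?_, hY, hP⟩
  have h8 : ε / K * n ≤ 8 * ε ^ 2 * n := by gcongr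
  linarith

lemma lt_duoBound (hk : 2 ≤ k) {ε : ℝ} (hε0 : 0 < ε) (hε1 : ε < 1 / 60) {K : ℕ}
    (hK : 1 / (8 * ε) ≤ K) (hK' : K ≤ 1 / (8 * ε) + 1) {n : ℕ} (hn : 10 * (K ^ 2 + 2) ≤ n) :
    ∃ c : ℕ, (1 - 8 * ε ^ 2) * n - √n * (2 * K ^ 2 + K + 6 + (1 + (2 * K + 2) ^ 2) * k) ≤
      duoBound k K (√n) c ⌊(1 - ε) * k * n⌋₊ n 0 := by
  have hk' : (2 : ℝ) ≤ k := by exact_mod_cast hk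
  have hnR : 10 * ((K : ℝ) ^ 2 + 2) ≤ n := by exact_mod_cast hn
  have hn0 : (1 : ℝ) ≤ n := by nlinarith
  have hm0 : 0 ≤ (1 - ε) * k * n := by
    have : 0 ≤ 1 - ε := by linarith
    positivity
  generalize hm : ⌊(1 - ε) * k * n⌋₊ = m
  have hm1 : (m : ℝ) ≤ (1 - ε) * k * n := hm ▸ Nat.floor_le hm0
  have hm2 : (1 - ε) * k * n < m + 1 := hm ▸ Nat.lt_floor_add_one _
  obtain ⟨c, hc3, hY, hP⟩ := exists_commit_count hk hε0 hε1 hK hK' hnR hm1 hm2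
  refine ⟨c, ?_⟩
  rw [duoBound, max_eq_right hP]
  have hss : √(n : ℝ) * √n = n := Real.mul_self_sqrt (by linarith)
  have hs1 : 1 ≤ √(n : ℝ) := Real.one_le_sqrt.mpr hn0
  generalize √(n : ℝ) = s at hss hs1
  have h6 : (((n : ℝ) - K * c - m / k) ^ 2 + 0 ^ 2 + (1 + (2 * K + 2) ^ 2) * m) / s ≤
      s * (K ^ 2 + (1 + (2 * K + 2) ^ 2) * k) := by
    rw [div_le_iff₀ (by linarith)]
    have h7 : (m : ℝ) ≤ k * n := by
      have : 0 ≤ ε * (k * n) := by positivity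
      linarith
    calc _ ≤ (K : ℝ) ^ 2 * 1 + 0 ^ 2 + (1 + (2 * K + 2) ^ 2) * (k * n) := by
          gcongr
          rwa [mul_one]
      _ ≤ (K : ℝ) ^ 2 * n + 0 ^ 2 + (1 + (2 * K + 2) ^ 2) * (k * n) := by gcongr
      _ = _ := by
        rw [← hss]
        ring
  have h9 : (K : ℝ) ^ 2 + K + 5 ≤ s * (K ^ 2 + K + 5) := by
    apply le_mul_of_one_le_left (by positivity) hs1
  linarith

lemma lower_bound (hk : 2 ≤ k) {ε : ℝ} (hε0 : 0 < ε) (hε1 : ε < 1 / 60) {γ : ℝ}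
    (hγ : Tendsto (fun n : ℕ => expLCS k n ⌊(1 - ε) * k * n⌋₊ / n) atTop (nhds γ)) :
    1 - 8 * ε ^ 2 ≤ γ := by
  obtain ⟨K, hK, hK'⟩ : ∃ K : ℕ, 1 / (8 * ε) ≤ K ∧ K ≤ 1 / (8 * ε) + 1 :=
    ⟨_, Nat.le_ceil _, (Nat.ceil_lt_add_one (by positivity)).le⟩
  have hK1 : 1 ≤ K := by
    have : (0 : ℝ) < K := lt_of_lt_of_le (by positivity) hK
    exact_mod_cast this
  set A : ℝ := 2 * K ^ 2 + K + 6 + (1 + (2 * K + 2) ^ 2) * k with hA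
  have h1 : Tendsto (fun n : ℕ => 1 - 8 * ε ^ 2 - A / √(n : ℝ)) atTop
      (nhds (1 - 8 * ε ^ 2 - 0)) :=
    tendsto_const_nhds.sub (tendsto_const_nhds.div_atTop
      (Real.tendsto_sqrt_atTop.comp tendsto_natCast_atTop_atTop))
  rw [sub_zero] at h1
  refine le_of_tendsto_of_tendsto h1 hγ ?_
  filter_upwards [eventually_ge_atTop (10 * (K ^ 2 + 2))] with n hn
  have hn0 : 0 < n := by omega
  have hn0' : (0 : ℝ) < n := by exact_mod_cast hn0
  obtain ⟨c, hc⟩ := lt_duoBound hk hε0 hε1 hK hK' hn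
  have h2 := hc.trans (duoBound_le_expLCS (by omega) hK1 (Real.sqrt_pos.mpr hn0') c _ hn0)
  rw [le_div_iff₀ hn0', sub_mul]
  have h3 : A / √(n : ℝ) * n = √n * A := by
    have := Real.mul_self_sqrt hn0'.le
    have h4 : √(n : ℝ) ≠ 0 := (Real.sqrt_pos.mpr hn0').ne'
    rw [div_mul_eq_mul_div, div_eq_iff h4, mul_right_comm, this, mul_comm]
  linarith

end LowerBound

section Lines

/-- Whether position `a` of the word `W` carries the letter `x`. -/
def hit (W : List ℕ) (x a : ℕ) : ℕ := if W[a]? = some x then 1 else 0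

/-- One step of the system of lines `f`: every line advances if it sees the letter `x`, and pushes
the lines above it. -/
def lineStep (W : List ℕ) (x : ℕ) (f : ℕ → ℕ) : ℕ → ℕ
  | 0 => f 0 + hit W x (f 0)
  | j + 1 => max (f (j + 1) + hit W x (f (j + 1))) (lineStep W x f j + 1)

/-- Evolution of the system of lines while reading a word. -/
def lineRun {k : ℕ} (W : List ℕ) : List (Fin k) → (ℕ → ℕ) → ℕ → ℕ
  | [], f => f
  | x :: y, f => lineRun W y (lineStep W (letter x) f)

/-- The word `v` has a common subsequence with `W.drop a` which misses at most `s` letters. -/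
def NearlyEmbeds (W : List ℕ) (a s : ℕ) (v : List ℕ) : Prop :=
  ∃ u : List ℕ, u.Sublist (W.drop a) ∧ u.Sublist v ∧ W.length ≤ a + u.length + s

lemma NearlyEmbeds.mono {W : List ℕ} {a a' s : ℕ} {v : List ℕ} (h : NearlyEmbeds W a s v)
    (ha : a ≤ a') : NearlyEmbeds W a' s v := by
  obtain ⟨u, h1, h2, h3⟩ := h
  obtain ⟨d, rfl⟩ := Nat.exists_eq_add_of_le ha
  refine ⟨u.drop d, ?_, (List.drop_sublist _ _).trans h2, ?_⟩
  · rw [← List.drop_drop]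
    exact h1.drop d
  · rw [List.length_drop]
    omega

lemma exists_getElem_of_cons_sublist {x : ℕ} {u l : List ℕ} (h : (x :: u).Sublist l) :
    ∃ d, l[d]? = some x ∧ u.Sublist (l.drop (d + 1)) := by
  induction l with
  | nil => simp at h
  | cons y l ih =>
    cases h with
    | cons _ h =>
      obtain ⟨d, h1, h2⟩ := ih h
      exact ⟨d + 1, by simpa using h1, by simpa using h2⟩
    | cons_cons _ h => exact ⟨0, by simp, by simpa using h⟩

lemma add_hit_le_lineStep (W : List ℕ) (x : ℕ) (f : ℕ → ℕ) (j : ℕ) :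
    f j + hit W x (f j) ≤ lineStep W x f j := by
  cases j with
  | zero => exact le_rfl
  | succ j => exact le_max_left _ _

lemma lineStep_succ_le (W : List ℕ) (x : ℕ) (f : ℕ → ℕ) (j : ℕ) :
    lineStep W x f j + 1 ≤ lineStep W x f (j + 1) :=
  le_max_right _ _

lemma lineStep_eq_of_ne {W : List ℕ} {x : ℕ} {f : ℕ → ℕ} {j : ℕ}
    (h : lineStep W x f (j + 1) ≠ lineStep W x f j + 1) :
    lineStep W x f (j + 1) = f (j + 1) + hit W x (f (j + 1)) := by
  simp only [lineStep] at h ⊢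
  omega

lemma add_le_of_succ_le {f : ℕ → ℕ} (hf : ∀ j, f j + 1 ≤ f (j + 1)) (j d : ℕ) :
    f j + d ≤ f (j + d) := by
  induction d with
  | zero => exact le_rfl
  | succ d ih =>
    have := hf (j + d)
    rw [← Nat.add_assoc, ← Nat.add_assoc]
    omega

lemma NearlyEmbeds.exists_lineRun {k : ℕ} {W : List ℕ} {f : ℕ → ℕ}
    (hf : ∀ j, f j + 1 ≤ f (j + 1)) {j s : ℕ} {y : List (Fin k)} {v : List ℕ}
    (h : NearlyEmbeds W (f j) s (y.map letter ++ v)) :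
    ∃ d ≤ s, NearlyEmbeds W (lineRun W y f (j + d)) (s - d) v := by
  induction y generalizing f j s with
  | nil => exact ⟨0, Nat.zero_le _, h⟩
  | cons x y ih =>
    obtain ⟨u, h1, h2, h3⟩ := h
    have hf' := lineStep_succ_le W (letter x) f
    have hstep := add_hit_le_lineStep W (letter x) f
    rw [List.map_cons, List.cons_append] at h2
    cases h2 with
    | cons _ h2 =>
      have : NearlyEmbeds W (f j) s (y.map letter ++ v) := ⟨u, h1, h2, h3⟩
      exact ih hf' (this.mono (by have := hstep j; omega))
    | cons_cons _ h2 =>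
      rename_i u
      obtain ⟨d, hd1, hd2⟩ := exists_getElem_of_cons_sublist h1
      rw [List.drop_drop] at hd2
      rw [List.getElem?_drop] at hd1
      have hlt : f j + d < W.length := (List.getElem?_eq_some_iff.mp hd1).1
      have hlen := hd2.length_le
      rw [List.length_drop] at hlen
      rw [List.length_cons] at h3
      have hds : d ≤ s := by omega
      have h4 : NearlyEmbeds W (f j + d + 1) (s - d) (y.map letter ++ v) :=
        ⟨u, hd2, h2, by omega⟩
      have h5 : f j + d + 1 ≤ lineStep W (letter x) f (j + d) := by
        have h6 := add_le_of_succ_le hf j d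
        have h7 := hstep (j + d)
        rcases h6.eq_or_lt with h8 | h8
        · rw [hit, ← h8, if_pos hd1] at h7
          exact h7
        · omega
      obtain ⟨d', hd', h9⟩ := ih hf' (h4.mono h5)
      refine ⟨d + d', by omega, ?_⟩
      rw [← Nat.add_assoc, ← Nat.sub_sub]
      exact h9

end Lines

section Potential

variable {r : ℕ}

/-- Concave quadratic functional of a distribution `π` on the lines with heights `g`. -/
noncomputable def quadPot (μ : ℝ) (g π : Fin (r + 1) → ℝ) : ℝ :=
  ∑ j, π j * g j - μ / 2 * ∑ j, π j ^ 2

/-- Maximum of `quadPot` over all distributions. -/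
noncomputable def maxPot (μ : ℝ) (g : Fin (r + 1) → ℝ) : ℝ :=
  sSup (quadPot μ g '' stdSimplex ℝ (Fin (r + 1)))

lemma exists_maxPot_eq (μ : ℝ) (g : Fin (r + 1) → ℝ) :
    ∃ π ∈ stdSimplex ℝ (Fin (r + 1)), maxPot μ g = quadPot μ g π ∧
      ∀ π' ∈ stdSimplex ℝ (Fin (r + 1)), quadPot μ g π' ≤ quadPot μ g π := by
  have hc : Continuous (quadPot μ g) := by
    unfold quadPot
    fun_prop
  exact (isCompact_stdSimplex ℝ (Fin (r + 1))).exists_sSup_image_eq_and_ge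
    ⟨_, single_mem_stdSimplex ℝ 0⟩ hc.continuousOn

lemma quadPot_le_maxPot (μ : ℝ) (g : Fin (r + 1) → ℝ) {π : Fin (r + 1) → ℝ}
    (hπ : π ∈ stdSimplex ℝ (Fin (r + 1))) : quadPot μ g π ≤ maxPot μ g := by
  obtain ⟨π', -, h1, h2⟩ := exists_maxPot_eq μ g
  exact h1 ▸ h2 π hπ

lemma quadPot_add_smul (μ : ℝ) (g π d : Fin (r + 1) → ℝ) (t : ℝ) :
    quadPot μ g (π + t • d) = quadPot μ g π + t * (∑ j, d j * g j - μ * ∑ j, π j * d j) -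
      t ^ 2 * (μ / 2 * ∑ j, d j ^ 2) := by
  simp only [quadPot, Pi.add_apply, Pi.smul_apply, smul_eq_mul, Finset.mul_sum, mul_sub,
    ← Finset.sum_sub_distrib, ← Finset.sum_add_distrib]
  refine Finset.sum_congr rfl fun j _ => ?_
  ring

/-- First-order optimality condition. -/
lemma deriv_quadPot_nonpos {μ : ℝ} {g π π' : Fin (r + 1) → ℝ}
    (hπ : π ∈ stdSimplex ℝ (Fin (r + 1)))
    (hmax : ∀ π' ∈ stdSimplex ℝ (Fin (r + 1)), quadPot μ g π' ≤ quadPot μ g π)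
    (hπ' : π' ∈ stdSimplex ℝ (Fin (r + 1))) :
    ∑ j, (π' - π) j * g j - μ * ∑ j, π j * (π' - π) j ≤ 0 := by
  set A := ∑ j, (π' - π) j * g j - μ * ∑ j, π j * (π' - π) j with hA
  set D := μ / 2 * ∑ j, (π' - π) j ^ 2 with hD
  have key : ∀ t : ℝ, 0 < t → t ≤ 1 → A ≤ t * D := by
    intro t ht ht1
    have h1 := hmax _ ((convex_stdSimplex ℝ (Fin (r + 1))).add_smul_sub_mem hπ hπ' ⟨ht.le, ht1⟩)
    rw [quadPot_add_smul, ← hA, ← hD] at h1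
    have h2 : t * A ≤ t * (t * D) := by nlinarith
    exact le_of_mul_le_mul_left h2 ht
  by_contra! h
  have h1 := key 1 one_pos le_rfl
  rw [one_mul] at h1
  have hD0 : 0 < D := h.trans_le h1
  have h2 := key (A / (2 * D)) (by positivity) (by
    rw [div_le_one (by positivity)]
    linarith)
  have h3 : A / (2 * D) * D = A / 2 := by
    field_simp
  linarith

lemma quadPot_le_sub {μ : ℝ} {g π π' : Fin (r + 1) → ℝ}
    (hπ : π ∈ stdSimplex ℝ (Fin (r + 1)))
    (hmax : ∀ π' ∈ stdSimplex ℝ (Fin (r + 1)), quadPot μ g π' ≤ quadPot μ g π)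
    (hπ' : π' ∈ stdSimplex ℝ (Fin (r + 1))) :
    quadPot μ g π' ≤ quadPot μ g π - μ / 2 * ∑ j, (π' j - π j) ^ 2 := by
  have h1 := deriv_quadPot_nonpos hπ hmax hπ'
  have h2 := quadPot_add_smul μ g π (π' - π) 1
  rw [one_smul, add_sub_cancel] at h2
  simp only [Pi.sub_apply] at h1 h2
  linarith

/-- A line which is pushed by the one below it carries no mass. -/
lemma eq_zero_of_pushed {μ : ℝ} (hμ : 0 < μ) {g π : Fin (r + 1) → ℝ}
    (hπ : π ∈ stdSimplex ℝ (Fin (r + 1)))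
    (hmax : ∀ π' ∈ stdSimplex ℝ (Fin (r + 1)), quadPot μ g π' ≤ quadPot μ g π)
    {i j : Fin (r + 1)} (hij : i ≠ j) (hg : g j ≤ g i - μ) : π j = 0 := by
  set π' : Fin (r + 1) → ℝ := π + (Pi.single i (π j) - Pi.single j (π j)) with hπ'
  have hj := hπ.1 j
  have hmem : π' ∈ stdSimplex ℝ (Fin (r + 1)) := by
    constructor
    · intro a
      have ha := hπ.1 a
      by_cases h1 : a = i
      · subst h1
        simp [hπ', hij]
        linarith
      · by_cases h2 : a = j
        · subst h2
          simp [hπ', h1]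
        · simpa [hπ', h1, h2] using ha
    · simp [hπ', Finset.sum_add_distrib, hπ.2]
  have h1 := deriv_quadPot_nonpos hπ hmax hmem
  have e : π' - π = Pi.single i (π j) - Pi.single j (π j) := by
    rw [hπ', add_sub_cancel_left]
  have e1 (h : Fin (r + 1) → ℝ) :
      ∑ a, (Pi.single i (π j) - Pi.single j (π j) : Fin (r + 1) → ℝ) a * h a =
        π j * (h i - h j) := by
    simp [sub_mul, Finset.sum_sub_distrib, Pi.single_apply, mul_sub]
  rw [e] at h1
  simp only [mul_comm (π _) ((Pi.single i (π j) - Pi.single j (π j) : Fin (r + 1) → ℝ) _),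
    e1] at h1
  have h2 : π i + π j ≤ 1 := by
    rw [← hπ.2, ← Finset.sum_pair hij]
    exact Finset.sum_le_sum_of_subset_of_nonneg (Finset.subset_univ _) fun a _ _ => hπ.1 a
  have h3 : π j * (g i - g j - μ * (π i - π j)) ≤ 0 := by linarith
  have h4 : μ * (2 * π j) ≤ g i - g j - μ * (π i - π j) := by nlinarith
  have h5 : π j * (μ * (2 * π j)) ≤ 0 := (mul_le_mul_of_nonneg_left h4 hj).trans h3
  have h6 : π j ^ 2 ≤ 0 := by
    by_contra! h
    have : 0 < π j * (μ * (2 * π j)) := by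
      have : 0 < 2 * μ * π j ^ 2 := by positivity
      linarith
    linarith
  exact pow_eq_zero_iff two_ne_zero |>.mp (le_antisymm h6 (sq_nonneg _))

end Potential

section LinePotential

/-- Potential of the first `r + 1` lines of the system `f`. -/
noncomputable def linePot (μ : ℝ) (r : ℕ) (f : ℕ → ℕ) : ℝ :=
  maxPot μ fun j : Fin (r + 1) => (f j : ℝ) - (μ + 1) * j

lemma le_linePot (μ : ℝ) (r : ℕ) (f : ℕ → ℕ) :
    (f r : ℝ) - (μ + 1) * r - μ / 2 ≤ linePot μ r f := by
  refine le_trans (le_of_eq ?_) (quadPot_le_maxPot μ _ (single_mem_stdSimplex ℝ (Fin.last r)))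
  simp [quadPot, Pi.single_apply, ite_pow]

lemma linePot_add_le {μ : ℝ} (hμ : 0 ≤ μ) (r a : ℕ) : linePot μ r (fun j => a + j) ≤ a := by
  obtain ⟨π, hπ, h1, -⟩ := exists_maxPot_eq μ
    fun j : Fin (r + 1) => ((a + j : ℕ) : ℝ) - (μ + 1) * j
  rw [linePot, h1, quadPot]
  have h2 : 0 ≤ μ / 2 * ∑ j, π j ^ 2 := by positivity
  have h3 : ∑ j, π j * (((a + j : ℕ) : ℝ) - (μ + 1) * j) ≤ ∑ j, π j * a := by
    gcongr with j
    · exact hπ.1 j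
    · push_cast
      have : 0 ≤ μ * (j : ℝ) := by positivity
      linarith
  rw [← Finset.sum_mul, hπ.2, one_mul] at h3
  linarith

lemma linePot_lineStep_le {μ : ℝ} (hμ : 0 < μ) (W : List ℕ) (r : ℕ) (f : ℕ → ℕ) :
    ∃ π ∈ stdSimplex ℝ (Fin (r + 1)), ∀ x,
      linePot μ r (lineStep W x f) ≤ linePot μ r f + 1 ∧
      linePot μ r (lineStep W x f) ≤ linePot μ r f +
        ∑ j : Fin (r + 1), (π j + 1 / (2 * μ)) * hit W x (f j) := by
  obtain ⟨π, hπ, hU, hmax⟩ := exists_maxPot_eq μ fun j : Fin (r + 1) => (f j : ℝ) - (μ + 1) * j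
  refine ⟨π, hπ, fun x => ?_⟩
  obtain ⟨π', hπ', hU', hmax'⟩ := exists_maxPot_eq μ
    fun j : Fin (r + 1) => (lineStep W x f j : ℝ) - (μ + 1) * j
  have h1 (j : Fin (r + 1)) : π' j * ((lineStep W x f j : ℝ) - (μ + 1) * j) =
      π' j * ((f j : ℝ) - (μ + 1) * j) + π' j * hit W x (f j) := by
    obtain ⟨j, hj⟩ := j
    cases j with
    | zero =>
      simp [lineStep]
      ring
    | succ j =>
      by_cases h : lineStep W x f (j + 1) = lineStep W x f j + 1
      · rw [eq_zero_of_pushed hμ hπ' hmax' (i := ⟨j, by omega⟩) (j := ⟨j + 1, hj⟩) (by simp)]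
        · simp
        · simp only [h]
          push_cast
          linarith
      · simp only [lineStep_eq_of_ne h]
        push_cast
        ring
  have h2 : linePot μ r (lineStep W x f) =
      quadPot μ (fun j : Fin (r + 1) => (f j : ℝ) - (μ + 1) * j) π' +
        ∑ j, π' j * hit W x (f j) := by
    rw [linePot, hU', quadPot, quadPot]
    simp only [h1, Finset.sum_add_distrib]
    ring
  have hhit (a : ℕ) : (hit W x a : ℝ) ≤ 1 ∧ (hit W x a : ℝ) ^ 2 = hit W x a := by
    unfold hit
    split_ifs <;> simp
  have hU2 : linePot μ r f = quadPot μ (fun j : Fin (r + 1) => (f j : ℝ) - (μ + 1) * j) π := hU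
  rw [h2, hU2]
  constructor
  · have h3 : ∑ j : Fin (r + 1), π' j * (hit W x (f j) : ℝ) ≤ ∑ j, π' j * 1 := by
      gcongr with j
      · exact hπ'.1 j
      · exact (hhit _).1
    simp only [mul_one, hπ'.2] at h3
    linarith [hmax π' hπ']
  · have h3 := quadPot_le_sub hπ hmax hπ'
    have h4 : ∑ j : Fin (r + 1), π' j * (hit W x (f j) : ℝ) ≤
        ∑ j : Fin (r + 1), ((π j + 1 / (2 * μ)) * hit W x (f j) + μ / 2 * (π' j - π j) ^ 2) := by
      refine Finset.sum_le_sum fun j _ => ?_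
      have h5 : (π j + 1 / (2 * μ)) * hit W x (f j) + μ / 2 * (π' j - π j) ^ 2 -
          π' j * (hit W x (f j) : ℝ) =
          1 / (2 * μ) * (hit W x (f j) - μ * (π' j - π j)) ^ 2 +
            1 / (2 * μ) * (hit W x (f j) - (hit W x (f j) : ℝ) ^ 2) := by
        field_simp
        ring
      rw [(hhit _).2, sub_self, mul_zero, add_zero] at h5
      have h6 : 0 ≤ 1 / (2 * μ) * (hit W x (f j) - μ * (π' j - π j)) ^ 2 := by positivity
      linarith
    rw [Finset.sum_add_distrib, ← Finset.mul_sum] at h4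
    linarith

lemma exp_mul_le_one_add {θ S Δ : ℝ} (hθ : 0 ≤ θ) (hS : 0 ≤ S) (h1 : Δ ≤ 1) (h2 : Δ ≤ S) :
    Real.exp (θ * Δ) ≤ 1 + (Real.exp θ - 1) * S := by
  have hη : 0 ≤ Real.exp θ - 1 := by
    have := Real.add_one_le_exp θ
    linarith
  rcases le_total S 1 with h | h
  · calc Real.exp (θ * Δ) ≤ Real.exp (θ * S) := by gcongr
      _ ≤ 1 + (Real.exp θ - 1) * S := by
        have := convexOn_exp.2 (Set.mem_univ θ) (Set.mem_univ 0) hS (sub_nonneg.mpr h)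
          (by ring)
        simp only [smul_eq_mul, mul_zero, add_zero, Real.exp_zero, mul_one] at this
        rw [mul_comm θ]
        linarith
  · calc Real.exp (θ * Δ) ≤ Real.exp (θ * 1) := by gcongr
      _ = 1 + (Real.exp θ - 1) * 1 := by
        rw [mul_one]
        ring
      _ ≤ _ := by gcongr

variable {k : ℕ}

lemma letter_injective : Function.Injective (letter : Fin k → ℕ) := fun x y h => by
  simpa [letter, Fin.ext_iff] using h

lemma sum_hit_le_one (W : List ℕ) (a : ℕ) : ∑ x : Fin k, (hit W (letter x) a : ℝ) ≤ 1 := by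
  by_cases h : ∃ x : Fin k, W[a]? = some (letter x)
  · obtain ⟨x, hx⟩ := h
    rw [Finset.sum_eq_single x]
    · simp [hit, hx]
    · intro y _ hy
      simp [hit, hx, (letter_injective (k := k)).eq_iff, hy.symm]
    · simp
  · push Not at h
    simp [hit, h]

lemma avg_exp_linePot_le {μ θ : ℝ} (hμ : 0 < μ) (hθ : 0 ≤ θ) (W : List ℕ) (r τ : ℕ)
    (f : ℕ → ℕ) :
    (avg k τ fun y => Real.exp (θ * linePot μ r (lineRun W y f))) ≤
      (1 + (Real.exp θ - 1) / k * (1 + (r + 1) / (2 * μ))) ^ τ *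
        Real.exp (θ * linePot μ r f) := by
  have hη : 0 ≤ Real.exp θ - 1 := by
    have := Real.add_one_le_exp θ
    linarith
  rcases Nat.eq_zero_or_pos k with rfl | hk
  · cases τ with
    | zero => simp [avg, lineRun]
    | succ τ =>
      simp only [avg, Nat.cast_zero, div_zero, zero_mul, add_zero, one_pow, one_mul]
      positivity
  have hk' : (0 : ℝ) < k := by exact_mod_cast hk
  set G := 1 + (Real.exp θ - 1) / k * (1 + (r + 1) / (2 * μ)) with hG
  have hG0 : 0 ≤ G := by positivity
  induction τ generalizing f with
  | zero => simp [avg, lineRun]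
  | succ τ ih =>
    obtain ⟨π, hπ, h1⟩ := linePot_lineStep_le hμ W r f
    simp only [avg, lineRun]
    have h2 (x : Fin k) : Real.exp (θ * linePot μ r (lineStep W (letter x) f)) ≤
        (1 + (Real.exp θ - 1) * ∑ j : Fin (r + 1), (π j + 1 / (2 * μ)) * hit W (letter x) (f j)) *
          Real.exp (θ * linePot μ r f) := by
      obtain ⟨h3, h4⟩ := h1 (letter x)
      have h5 : 0 ≤ ∑ j : Fin (r + 1), (π j + 1 / (2 * μ)) * (hit W (letter x) (f j) : ℝ) :=
        Finset.sum_nonneg fun j _ => by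
          have := hπ.1 j
          positivity
      have h6 := exp_mul_le_one_add hθ h5 (sub_le_iff_le_add'.mpr h3) (sub_le_iff_le_add'.mpr h4)
      calc Real.exp (θ * linePot μ r (lineStep W (letter x) f)) =
          Real.exp (θ * (linePot μ r (lineStep W (letter x) f) - linePot μ r f)) *
            Real.exp (θ * linePot μ r f) := by
            rw [← Real.exp_add]
            ring_nf
        _ ≤ _ := by gcongr
    have h7 : ∑ x : Fin k, ∑ j : Fin (r + 1), (π j + 1 / (2 * μ)) * (hit W (letter x) (f j) : ℝ) ≤
        1 + (r + 1) / (2 * μ) := by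
      rw [Finset.sum_comm]
      calc _ ≤ ∑ j : Fin (r + 1), (π j + 1 / (2 * μ)) * 1 := by
            simp only [← Finset.mul_sum]
            refine Finset.sum_le_sum fun j _ => ?_
            have := hπ.1 j
            have := sum_hit_le_one (k := k) W (f j)
            gcongr
        _ = _ := by
            simp only [mul_one, Finset.sum_add_distrib, hπ.2]
            simp
            ring
    rw [div_le_iff₀ hk']
    calc _ ≤ ∑ x : Fin k, G ^ τ * ((1 + (Real.exp θ - 1) *
          ∑ j : Fin (r + 1), (π j + 1 / (2 * μ)) * hit W (letter x) (f j)) *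
          Real.exp (θ * linePot μ r f)) := by
          refine Finset.sum_le_sum fun x _ => (ih _).trans ?_
          gcongr
          exact h2 x
      _ = G ^ τ * Real.exp (θ * linePot μ r f) * (k + (Real.exp θ - 1) *
          ∑ x : Fin k, ∑ j : Fin (r + 1), (π j + 1 / (2 * μ)) * hit W (letter x) (f j)) := by
          rw [← Finset.mul_sum, ← Finset.sum_mul, Finset.sum_add_distrib, ← Finset.mul_sum]
          simp
          ring
      _ ≤ G ^ τ * Real.exp (θ * linePot μ r f) * (k + (Real.exp θ - 1) *
          (1 + (r + 1) / (2 * μ))) := by gcongr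
      _ = _ := by
          rw [pow_succ, hG]
          field_simp

/-- Exponential moment of the position of line `r` after reading `k * ℓ` random letters. -/
lemma avg_exp_lineRun_le {μ θ : ℝ} (hμ : 0 < μ) (hθ : 0 ≤ θ) (hk : 0 < k) (W : List ℕ)
    (r ℓ a : ℕ) :
    (avg k (k * ℓ) fun y => Real.exp (θ * lineRun W y (fun j => a + j) r)) ≤
      Real.exp (θ * a) * Real.exp ((Real.exp θ - 1) * ℓ * (1 + 1 / (2 * μ)) + θ * μ / 2) *
        Real.exp (θ * (μ + 1) + (Real.exp θ - 1) * ℓ / (2 * μ)) ^ r := by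
  have hk' : (0 : ℝ) < k := by exact_mod_cast hk
  have hη : 0 ≤ Real.exp θ - 1 := by
    have := Real.add_one_le_exp θ
    linarith
  have h1 (y : List (Fin k)) : Real.exp (θ * lineRun W y (fun j => a + j) r) ≤
      Real.exp (θ * ((μ + 1) * r + μ / 2)) *
        Real.exp (θ * linePot μ r (lineRun W y fun j => a + j)) := by
    rw [← Real.exp_add, ← mul_add]
    gcongr
    linarith [le_linePot μ r (lineRun W y fun j => a + j)]
  refine (avg_mono _ h1).trans ?_
  rw [avg_const_mul]
  have h2 := avg_exp_linePot_le (k := k) hμ hθ W r (k * ℓ) fun j => a + j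
  have h3 : (1 + (Real.exp θ - 1) / k * (1 + (r + 1) / (2 * μ))) ^ (k * ℓ) ≤
      Real.exp ((Real.exp θ - 1) * ℓ * (1 + (r + 1) / (2 * μ))) := by
    calc _ ≤ Real.exp ((Real.exp θ - 1) / k * (1 + (r + 1) / (2 * μ))) ^ (k * ℓ) := by
          gcongr
          rw [add_comm]
          exact Real.add_one_le_exp _
      _ = _ := by
          rw [← Real.exp_nat_mul]
          congr 1
          push_cast
          field_simp
  calc _ ≤ Real.exp (θ * ((μ + 1) * r + μ / 2)) *
        (Real.exp ((Real.exp θ - 1) * ℓ * (1 + (r + 1) / (2 * μ))) * Real.exp (θ * a)) := by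
        refine mul_le_mul_of_nonneg_left (h2.trans ?_) (Real.exp_nonneg _)
        gcongr
        exact linePot_add_le hμ.le r a
    _ = _ := by
        rw [← Real.exp_nat_mul, ← Real.exp_add, ← Real.exp_add, ← Real.exp_add, ← Real.exp_add]
        congr 1
        ring

end LinePotential

section Tail

open Classical in
/-- Indicator of `NearlyEmbeds`. -/
noncomputable def nearInd (W : List ℕ) (a s : ℕ) (v : List ℕ) : ℝ :=
  if NearlyEmbeds W a s v then 1 else 0

lemma nearInd_nonneg (W : List ℕ) (a s : ℕ) (v : List ℕ) : 0 ≤ nearInd W a s v := by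
  unfold nearInd
  split_ifs <;> simp

lemma nearInd_of_nearlyEmbeds {W : List ℕ} {a s : ℕ} {v : List ℕ} (h : NearlyEmbeds W a s v) :
    nearInd W a s v = 1 := if_pos h

variable {k : ℕ}

lemma nearInd_append_le (W : List ℕ) (a s : ℕ) (y : List (Fin k)) (v : List ℕ) :
    nearInd W a s (y.map letter ++ v) ≤
      ∑ d ∈ Finset.range (s + 1), nearInd W (lineRun W y (fun j => a + j) d) (s - d) v := by
  have h0 : ∀ d ∈ Finset.range (s + 1),
      0 ≤ nearInd W (lineRun W y (fun j => a + j) d) (s - d) v := fun d _ => nearInd_nonneg _ _ _ _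
  by_cases h : NearlyEmbeds W a s (y.map letter ++ v)
  · obtain ⟨d, hd, h1⟩ := NearlyEmbeds.exists_lineRun (f := fun j => a + j) (j := 0)
      (fun j => le_rfl) h
    rw [zero_add] at h1
    rw [nearInd_of_nearlyEmbeds h, ← nearInd_of_nearlyEmbeds h1]
    exact Finset.single_le_sum h0 (Finset.mem_range.mpr (by omega))
  · rw [nearInd, if_neg h]
    exact Finset.sum_nonneg h0

lemma avg_nearInd_le (W : List ℕ) {θ B X : ℝ} {τ : ℕ} (hB0 : 0 < B) (hX : 0 ≤ X)
    (hB : Real.exp θ ≤ 2 * B)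
    (hmom : ∀ a r : ℕ, (avg k τ fun y => Real.exp (θ * lineRun W y (fun j => a + j) r)) ≤
      Real.exp (θ * a) * (X / 2) * B ^ r) (hθ : 0 ≤ θ) (b a s : ℕ) :
    (avg k (b * τ) fun y => nearInd W a s (y.map letter)) ≤
      (2 * B) ^ s * Real.exp (θ * (a - W.length)) * X ^ b := by
  induction b generalizing a s with
  | zero =>
    simp only [zero_mul, avg, List.map_nil, pow_zero, mul_one]
    by_cases h : NearlyEmbeds W a s []
    · rw [nearInd_of_nearlyEmbeds h]
      obtain ⟨u, -, hu, h1⟩ := h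
      rw [List.sublist_nil] at hu
      rw [hu, List.length_nil, add_zero] at h1
      have h2 : (W.length : ℝ) ≤ a + s := by exact_mod_cast h1
      calc (1 : ℝ) ≤ Real.exp (s * θ + θ * (a - W.length)) := by
            rw [Real.one_le_exp_iff]
            nlinarith
        _ = Real.exp θ ^ s * Real.exp (θ * (a - W.length)) := by
          rw [Real.exp_add, Real.exp_nat_mul]
        _ ≤ _ := by gcongr
    · rw [nearInd, if_neg h]
      positivity
  | succ b ih =>
    rw [Nat.succ_mul, Nat.add_comm, avg_append]
    simp only [List.map_append]
    calc _ ≤ avg k τ fun y => avg k (b * τ) fun y' => ∑ d ∈ Finset.range (s + 1),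
          nearInd W (lineRun W y (fun j => a + j) d) (s - d) (y'.map letter) :=
          avg_mono _ fun y => avg_mono _ fun y' => nearInd_append_le _ _ _ _ _
      _ ≤ avg k τ fun y => ∑ d ∈ Finset.range (s + 1), (2 * B) ^ (s - d) *
          Real.exp (-(θ * W.length)) * X ^ b *
            Real.exp (θ * lineRun W y (fun j => a + j) d) := by
          refine avg_mono _ fun y => ?_
          rw [avg_sum]
          refine Finset.sum_le_sum fun d _ => (ih _ _).trans_eq ?_
          rw [mul_sub, sub_eq_add_neg, Real.exp_add]
          ring
      _ ≤ ∑ d ∈ Finset.range (s + 1), (2 * B) ^ (s - d) *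
          Real.exp (-(θ * W.length)) * X ^ b * (Real.exp (θ * a) * (X / 2) * B ^ d) := by
          rw [avg_sum]
          refine Finset.sum_le_sum fun d _ => ?_
          rw [avg_const_mul]
          have := hmom a d
          gcongr
      _ = (2 * B) ^ s * Real.exp (θ * (a - W.length)) * X ^ (b + 1) *
          ((∑ d ∈ Finset.range (s + 1), (1 / 2 : ℝ) ^ d) / 2) := by
          rw [Finset.sum_div, Finset.mul_sum]
          refine Finset.sum_congr rfl fun d hd => ?_
          have hd' : d ≤ s := by
            have := Finset.mem_range.mp hd
            omega
          have e : (2 * B) ^ s = (2 * B) ^ (s - d) * (2 * B) ^ d := by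
            rw [← pow_add, Nat.sub_add_cancel hd']
          have e2 : (2 * B) ^ d * (1 / 2) ^ d = B ^ d := by
            rw [← mul_pow]
            congr 1
            ring
          rw [e, mul_sub, sub_eq_add_neg, Real.exp_add, ← e2]
          ring
      _ ≤ (2 * B) ^ s * Real.exp (θ * (a - W.length)) * X ^ (b + 1) * 1 := by
          gcongr
          have := sum_geometric_two_le (s + 1)
          linarith
      _ = _ := mul_one _

lemma lcs_le_nearInd (u v : List (Fin k)) (s : ℕ) :
    (lcs u v : ℝ) ≤ u.length - (s + 1) + (s + 1) * nearInd (u.map letter) 0 s (v.map letter) := by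
  by_cases h : NearlyEmbeds (u.map letter) 0 s (v.map letter)
  · rw [nearInd_of_nearlyEmbeds h]
    have : (lcs u v : ℝ) ≤ u.length := by exact_mod_cast lcs_le_length u v
    linarith
  · rw [nearInd, if_neg h]
    obtain ⟨t, h1, h2, h3⟩ := exists_length_eq_LCSlen (u.map letter) (v.map letter)
    have h4 : lcs u v + (s + 1) ≤ u.length := by
      by_contra! h5
      rw [lcs, ← h3] at h5
      exact h ⟨t, by simpa using h1, h2, by simp; omega⟩
    have h5 : (lcs u v : ℝ) + (s + 1) ≤ u.length := by exact_mod_cast h4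
    linarith

lemma avg_lcs_mono (hk : 0 < k) (u : List (Fin k)) {m M : ℕ} (h : m ≤ M) :
    (avg k m fun v => (lcs u v : ℝ)) ≤ avg k M fun v => (lcs u v : ℝ) := by
  obtain ⟨d, rfl⟩ := Nat.exists_eq_add_of_le h
  rw [avg_append]
  refine avg_mono _ fun y => ?_
  rw [← avg_const hk d (lcs u y : ℝ)]
  refine avg_mono _ fun y' => ?_
  exact_mod_cast lcs_mono (List.Sublist.refl u) (List.sublist_append_left y y')

lemma expLCS_le_of_tail (hk : 0 < k) {n m M s : ℕ} (h : m ≤ M) {P : ℝ}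
    (hP : ∀ W : List ℕ, W.length = n → (avg k M fun v => nearInd W 0 s (v.map letter)) ≤ P) :
    expLCS k n m ≤ n - (s + 1) * (1 - P) := by
  have hk' : (0 : ℝ) < (k : ℝ) ^ n := by positivity
  rw [expLCS_eq_avg, avg_eq_sum, div_le_iff₀ hk']
  have key (w : Fin n → Fin k) : (avg k m fun v => (lcs (List.ofFn w) v : ℝ)) ≤
      n - (s + 1) * (1 - P) := by
    refine (avg_lcs_mono hk _ h).trans ((avg_mono M fun v => lcs_le_nearInd _ v s).trans ?_)
    rw [avg_add, avg_const hk, avg_const_mul, List.length_ofFn]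
    have h1 := mul_le_mul_of_nonneg_left (hP ((List.ofFn w).map letter) (by simp))
      (by positivity : (0 : ℝ) ≤ s + 1)
    linarith
  calc _ ≤ ∑ _w : Fin n → Fin k, ((n : ℝ) - (s + 1) * (1 - P)) :=
        Finset.sum_le_sum fun w _ => key w
    _ = _ := by
      rw [Finset.sum_const, Finset.card_univ, Fintype.card_fun, Fintype.card_fin,
        Fintype.card_fin, nsmul_eq_mul, mul_comm]
      push_cast
      rfl

end Tail

section UpperBound

lemma exp_half_sub_one_le {ε : ℝ} (hε0 : 0 < ε) (hε1 : ε < 1 / 60) :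
    Real.exp (ε / 2) - 1 ≤ ε / 2 + 126 / 1000 * ε ^ 2 := by
  have h1 : |ε / 2| ≤ 1 := by
    rw [abs_of_pos (by linarith)]
    linarith
  have h2 := Real.exp_bound h1 (n := 3) (by norm_num)
  rw [abs_of_pos (by linarith : 0 < ε / 2)] at h2
  have h3 := (abs_le.mp h2).2
  norm_num [Finset.sum_range_succ, Nat.factorial] at h3
  have h4 : ε ^ 3 ≤ 1 / 60 * ε ^ 2 := by
    rw [pow_succ, mul_comm]
    gcongr
  nlinarith

lemma log_base_le {ε η ℓ : ℝ} (hε0 : 0 < ε) (hε1 : ε < 1 / 60) (hη0 : 0 ≤ η)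
    (hη : η ≤ ε / 2 + 126 / 1000 * ε ^ 2) (hℓ' : ℓ * ε ^ 2 ≤ 20 + ε ^ 2) :
    Real.log 2 + (ε / 2 * (2 / ε + 1) + η * ℓ / (2 * (2 / ε))) ≤ 425 / 100 := by
  have h1 := Real.log_two_lt_d9
  have h2 : ε / 2 * (2 / ε + 1) = 1 + ε / 2 := by
    field_simp
  have h3 : η * ℓ / (2 * (2 / ε)) = η * ℓ * ε / 4 := by
    field_simp
    ring
  rw [h2, h3]
  have h4 : η * ε ≤ (1 / 2 + 126 / 60000) * ε ^ 2 := by nlinarith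
  have h5 : η * ℓ * ε ≤ (1 / 2 + 126 / 60000) * (20 + ε ^ 2) := by
    rcases le_total ℓ 0 with h | h
    · have : η * ℓ * ε ≤ 0 := by
        have : η * ℓ ≤ 0 := mul_nonpos_of_nonneg_of_nonpos hη0 h
        exact mul_nonpos_of_nonpos_of_nonneg this hε0.le
      nlinarith
    · nlinarith
  nlinarith

lemma log_block_le {ε η : ℝ} {n ℓ b : ℝ} (hε0 : 0 < ε) (hε1 : ε < 1 / 60) (hn : 0 ≤ n)
    (hη0 : 0 ≤ η) (hη : η ≤ ε / 2 + 126 / 1000 * ε ^ 2) (hℓ : 20 ≤ ℓ * ε ^ 2)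
    (hb : b * ℓ ≤ (1 - ε) * n) :
    b * (Real.log 2 + (η * ℓ * (1 + 1 / (2 * (2 / ε))) + ε / 2 * (2 / ε) / 2)) ≤
      (ε / 2 - 18 / 100 * ε ^ 2) * n := by
  have h1 := Real.log_two_lt_d9
  have h2 : ε / 2 * (2 / ε) / 2 = 1 / 2 := by
    field_simp
  have h3 : 1 / (2 * (2 / ε)) = ε / 4 := by
    field_simp
    ring
  rw [h2, h3]
  have hℓ0 : 0 < ℓ := by
    by_contra! h
    nlinarith [sq_nonneg ε]
  have h4 : Real.log 2 + (η * ℓ * (1 + ε / 4) + 1 / 2) ≤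
      ℓ * (6 / 100 * ε ^ 2 + η * (1 + ε / 4)) := by
    nlinarith
  have h5 : (1 - ε) * (6 / 100 * ε ^ 2 + η * (1 + ε / 4)) ≤ ε / 2 - 18 / 100 * ε ^ 2 := by
    have h6 : (1 - ε) * (1 + ε / 4) ≤ 1 - 3 / 4 * ε := by nlinarith
    have h7 : η * ((1 - ε) * (1 + ε / 4)) ≤ η * (1 - 3 / 4 * ε) := by gcongr
    have h8 : η * (1 - 3 / 4 * ε) ≤ (ε / 2 + 126 / 1000 * ε ^ 2) * (1 - 3 / 4 * ε) := by
      gcongr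
      linarith
    nlinarith [sq_nonneg ε, pow_pos hε0 3]
  have h0 : 0 ≤ Real.log 2 + (η * ℓ * (1 + ε / 4) + 1 / 2) := by
    have := Real.log_two_gt_d9
    positivity
  have hpos : 0 ≤ 6 / 100 * ε ^ 2 + η * (1 + ε / 4) := by positivity
  rcases le_total b 0 with hb0 | hb0
  · have h9 := mul_nonpos_of_nonpos_of_nonneg hb0 h0
    have h10 : 0 ≤ (ε / 2 - 18 / 100 * ε ^ 2) * n := by
      apply mul_nonneg _ hn
      nlinarith
    linarith
  · calc _ ≤ b * (ℓ * (6 / 100 * ε ^ 2 + η * (1 + ε / 4))) := by gcongr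
      _ = b * ℓ * (6 / 100 * ε ^ 2 + η * (1 + ε / 4)) := by ring
      _ ≤ (1 - ε) * n * (6 / 100 * ε ^ 2 + η * (1 + ε / 4)) := by gcongr
      _ = (1 - ε) * (6 / 100 * ε ^ 2 + η * (1 + ε / 4)) * n := by ring
      _ ≤ _ := by gcongr

variable {k : ℕ}

lemma exists_expLCS_le (hk : 2 ≤ k) {ε : ℝ} (hε0 : 0 < ε) (hε1 : ε < 1 / 60) :
    ∃ C : ℝ, ∀ n : ℕ, expLCS k n ⌊(1 - ε) * k * n⌋₊ ≤
      n - ((⌊ε ^ 2 * n / 72⌋₊ : ℝ) + 1) * (1 - C * Real.exp (-(ε ^ 2 / 10 * n))) := by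
  have hk' : (0 : ℝ) < k := by
    have : 0 < k := by omega
    exact_mod_cast this
  obtain ⟨ℓ, hℓ, hℓ'⟩ : ∃ ℓ : ℕ, 20 / ε ^ 2 ≤ ℓ ∧ ℓ ≤ 20 / ε ^ 2 + 1 :=
    ⟨_, Nat.le_ceil _, (Nat.ceil_lt_add_one (by positivity)).le⟩
  have hε2 : 0 < ε ^ 2 := by positivity
  rw [div_le_iff₀ hε2] at hℓ
  have hℓ'' : (ℓ : ℝ) * ε ^ 2 ≤ 20 + ε ^ 2 := by
    calc (ℓ : ℝ) * ε ^ 2 ≤ (20 / ε ^ 2 + 1) * ε ^ 2 := by gcongr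
      _ = _ := by
        field_simp
  have hℓ0 : (0 : ℝ) < ℓ := by
    by_contra! h
    nlinarith
  have hη := exp_half_sub_one_le hε0 hε1
  have hη0 : 0 ≤ Real.exp (ε / 2) - 1 := by
    have := Real.add_one_le_exp (ε / 2)
    linarith
  have hmom := fun (W : List ℕ) (a r : ℕ) => avg_exp_lineRun_le (k := k) (μ := 2 / ε)
    (θ := ε / 2) (by positivity) (by positivity) (by omega) W r ℓ a
  have hB := log_base_le hε0 hε1 hη0 hη hℓ''
  have hX := fun (n b : ℝ) (hn : 0 ≤ n) => log_block_le (n := n) (b := b) hε0 hε1 hn hη0 hη hℓ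
  have hBθ : ε / 2 ≤ ε / 2 * (2 / ε + 1) + (Real.exp (ε / 2) - 1) * ℓ / (2 * (2 / ε)) := by
    have h1 : ε / 2 * (2 / ε + 1) = 1 + ε / 2 := by
      field_simp
    have h2 : 0 ≤ (Real.exp (ε / 2) - 1) * ℓ / (2 * (2 / ε)) := by positivity
    linarith
  generalize ε / 2 * (2 / ε + 1) + (Real.exp (ε / 2) - 1) * ℓ / (2 * (2 / ε)) = β at *
  generalize (Real.exp (ε / 2) - 1) * ℓ * (1 + 1 / (2 * (2 / ε))) + ε / 2 * (2 / ε) / 2 = ξ at *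
  have two_exp (z : ℝ) : 2 * Real.exp z = Real.exp (Real.log 2 + z) := by
    rw [Real.exp_add, Real.exp_log two_pos]
  refine ⟨2 * Real.exp ξ, fun n => ?_⟩
  set m := ⌊(1 - ε) * k * n⌋₊ with hm
  have hm1 : (m : ℝ) ≤ (1 - ε) * k * n := by
    apply Nat.floor_le
    have : 0 ≤ 1 - ε := by linarith
    positivity
  set s := ⌊ε ^ 2 * n / 72⌋₊ with hs
  have hs1 : (s : ℝ) ≤ ε ^ 2 * n / 72 := Nat.floor_le (by positivity)
  have hτ : 0 < k * ℓ := by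
    have : 0 < ℓ := by exact_mod_cast hℓ0
    positivity
  set b := m / (k * ℓ) with hb
  have hbm : m ≤ (b + 1) * (k * ℓ) := by
    rw [mul_comm]
    exact (Nat.lt_mul_div_succ m hτ).le
  have hb1 : (b : ℝ) * ℓ ≤ (1 - ε) * n := by
    have h1 : b * (k * ℓ) ≤ m := Nat.div_mul_le_self m (k * ℓ)
    have h2 : (b : ℝ) * (k * ℓ) ≤ m := by exact_mod_cast h1
    refine le_of_mul_le_mul_left ?_ hk'
    linarith
  refine expLCS_le_of_tail (by omega) hbm fun W hW => ?_
  refine (avg_nearInd_le W (θ := ε / 2) (B := Real.exp β) (X := 2 * Real.exp ξ) (Real.exp_pos _)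
    (by positivity) ?_ ?_ (by positivity) (b + 1) 0 s).trans ?_
  · have : Real.exp (ε / 2) ≤ Real.exp β := Real.exp_le_exp.mpr hBθ
    linarith [Real.exp_pos β]
  · intro a r
    rw [mul_div_cancel_left₀ _ two_ne_zero]
    exact hmom W a r
  · have h1 := hX n b (Nat.cast_nonneg n) hb1
    have h2 : (s : ℝ) * (Real.log 2 + β) ≤ ε ^ 2 * n / 72 * (425 / 100) := by
      calc (s : ℝ) * (Real.log 2 + β) ≤ s * (425 / 100) := by gcongr
        _ ≤ _ := by gcongr
    rw [hW, two_exp, two_exp, ← Real.exp_nat_mul, ← Real.exp_nat_mul, ← Real.exp_add,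
      ← Real.exp_add, ← Real.exp_add, Real.exp_le_exp]
    push_cast
    have h3 : 0 ≤ ε ^ 2 * n := by positivity
    linarith

lemma upper_bound (hk : 2 ≤ k) {ε : ℝ} (hε0 : 0 < ε) (hε1 : ε < 1 / 60) {γ : ℝ}
    (hγ : Tendsto (fun n : ℕ => expLCS k n ⌊(1 - ε) * k * n⌋₊ / n) atTop (nhds γ)) :
    γ ≤ 1 - ε ^ 2 / 72 := by
  obtain ⟨C, hC⟩ := exists_expLCS_le hk hε0 hε1
  have hP : Tendsto (fun n : ℕ => C * Real.exp (-(ε ^ 2 / 10 * n))) atTop (nhds (C * 0)) := by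
    refine tendsto_const_nhds.mul (Real.tendsto_exp_neg_atTop_nhds_zero.comp ?_)
    exact tendsto_natCast_atTop_atTop.const_mul_atTop (by positivity)
  rw [mul_zero] at hP
  have h1 : Tendsto (fun n : ℕ => 1 - ε ^ 2 / 72 * (1 - C * Real.exp (-(ε ^ 2 / 10 * n)))) atTop
      (nhds (1 - ε ^ 2 / 72 * (1 - 0))) :=
    tendsto_const_nhds.sub (tendsto_const_nhds.mul (tendsto_const_nhds.sub hP))
  rw [sub_zero, mul_one] at h1
  refine le_of_tendsto_of_tendsto hγ h1 ?_
  filter_upwards [hP.eventually_le_const one_pos, eventually_gt_atTop 0] with n hn hn0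
  have hn0' : (0 : ℝ) < n := by exact_mod_cast hn0
  rw [div_le_iff₀ hn0']
  have h2 := (Nat.lt_floor_add_one (ε ^ 2 * n / 72)).le
  have h3 := mul_le_mul_of_nonneg_right h2 (sub_nonneg.mpr hn)
  linarith [hC n]

end UpperBound

/-- For every `k ≥ 2` and `0 < ε < 1/60`, the constant
`γ_{k,ε} = lim_{n → ∞} (1/n) E[LCS(w, w')]`, where `w ~ [k]^n` and `w' ~ [k]^{⌊(1-ε)kn⌋}`,
satisfies `1 - 8ε² ≤ γ_{k,ε} ≤ 1 - ε²/72`. -/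
theorem stmt0 (k : ℕ) (hk : 2 ≤ k) (ε : ℝ) (hε0 : 0 < ε) (hε1 : ε < 1 / 60) (γ : ℝ)
    (hγ : Tendsto (fun n : ℕ => expLCS k n ⌊(1 - ε) * k * n⌋₊ / n) atTop (nhds γ)) :
    1 - 8 * ε ^ 2 ≤ γ ∧ γ ≤ 1 - ε ^ 2 / 72 := by
  exact ⟨lower_bound hk hε0 hε1 hγ, upper_bound hk hε0 hε1 hγ⟩
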